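/- arXiv:2409.07026 — 7 statements merged into one kernel-verified Lean document; each statement's English description precedes it below -/
import Mathlib

section
/- Let (𝒜, ℬ, 𝒞) be a recollement of abelian categories, and let 𝒳' and 𝒳'' be wakamatsu tilting subcategories of 𝒜 and 𝒞, respectively. Define 𝒳 = {X ∈ ℬ | i^!(X) ∈ 𝒳' and j^*(X) ∈ 𝒳''}. If the functors i^! and i^* are exact, then 𝒳 is a wakamatsu tilting subcategory of ℬ. -/
open CategoryTheory Limits Abelian

universe w₁ w₂ w₃ v₁ v₂ v₃ u₁ u₂ u₃

/-- A recollement of abelian categories. Exactness conditions on the six functors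
(`i_*`, `j^*` exact; `i^*`, `j_!` right exact; `i^!`, `j_*` left exact) are automatic
from the adjunctions. -/
structure Recollement (𝒜 : Type u₁) (ℬ : Type u₂) (𝒞 : Type u₃)
    [Category.{v₁} 𝒜] [Category.{v₂} ℬ] [Category.{v₃} 𝒞]
    [Abelian 𝒜] [Abelian ℬ] [Abelian 𝒞] where
  /-- `i_* : 𝒜 ⥤ ℬ` -/
  iStar : 𝒜 ⥤ ℬ
  /-- `i^* : ℬ ⥤ 𝒜` -/
  iUS : ℬ ⥤ 𝒜
  /-- `i^! : ℬ ⥤ 𝒜` -/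
  iUE : ℬ ⥤ 𝒜
  /-- `j^* : ℬ ⥤ 𝒞` -/
  jUS : ℬ ⥤ 𝒞
  /-- `j_! : 𝒞 ⥤ ℬ` -/
  jLE : 𝒞 ⥤ ℬ
  /-- `j_* : 𝒞 ⥤ ℬ` -/
  jLS : 𝒞 ⥤ ℬ
  /-- the adjunction `(i^*, i_*)` -/
  adj₁ : iUS ⊣ iStar
  /-- the adjunction `(i_*, i^!)` -/
  adj₂ : iStar ⊣ iUE
  /-- the adjunction `(j_!, j^*)` -/
  adj₃ : jLE ⊣ jUS
  /-- the adjunction `(j^*, j_*)` -/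
  adj₄ : jUS ⊣ jLS
  iStar_full : iStar.Full
  iStar_faithful : iStar.Faithful
  jLE_full : jLE.Full
  jLE_faithful : jLE.Faithful
  jLS_full : jLS.Full
  jLS_faithful : jLS.Faithful
  /-- `Im i_* = Ker j^*` -/
  essImage_iStar : ∀ X : ℬ, iStar.essImage X ↔ IsZero (jUS.obj X)

variable {𝒟 : Type u₁} [Category.{v₁} 𝒟] [Abelian 𝒟]

/-- a subcategory (given by a set of objects) closed under isomorphisms and (finite) direct
sums. -/
def IsGoodSubcat (S : Set 𝒟) : Prop :=
  (∀ ⦃X Y : 𝒟⦄, (X ≅ Y) → X ∈ S → Y ∈ S) ∧ ∀ X Y : 𝒟, X ∈ S → Y ∈ S → (X ⊞ Y) ∈ S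

/-- exactness at `Y` of `X ⟶ Y ⟶ Z`. -/
def ExactAt {X Y Z : 𝒟} (f : X ⟶ Y) (g : Y ⟶ Z) : Prop :=
  ∃ w : f ≫ g = 0, (ShortComplex.mk f g w).Exact

section Ext
variable [HasExt.{w₁} 𝒟]

/-- `⊥S`: objects `M` with `Ext^i(M, N) = 0` for all `i ≥ 1`, `N ∈ S`. -/
def leftPerp (S : Set 𝒟) : Set 𝒟 :=
  {M | ∀ N ∈ S, ∀ i : ℕ, 1 ≤ i → Subsingleton (Ext M N i)}

/-- a self-orthogonal subcategory. -/
def SelfOrthogonal (S : Set 𝒟) : Prop :=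
  ∀ M ∈ S, ∀ N ∈ S, ∀ i : ℕ, 1 ≤ i → Subsingleton (Ext M N i)

/-- The subcategory `X_S` : objects `M ∈ ⊥S` admitting an exact sequence
`0 ⟶ M ⟶ W 0 ⟶ W 1 ⟶ ⋯` with all `W i ∈ S` and images of differentials in `⊥S`. -/
def wakClass (S : Set 𝒟) : Set 𝒟 :=
  {M | M ∈ leftPerp S ∧ ∃ (W : ℕ → 𝒟) (f : M ⟶ W 0) (d : ∀ n, W n ⟶ W (n + 1)),
    (∀ n, W n ∈ S) ∧ Mono f ∧ ExactAt f (d 0) ∧ (∀ n, ExactAt (d n) (d (n + 1))) ∧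
    (∀ n, image (d n) ∈ leftPerp S)}

/-- a wakamatsu tilting subcategory. -/
def WakamatsuTilting (S : Set 𝒟) : Prop :=
  SelfOrthogonal S ∧ ∀ P : 𝒟, Projective P → P ∈ wakClass S

end Ext

/-- `Fac S`. -/
def Fac (S : Set 𝒟) : Set 𝒟 :=
  {X | ∃ M ∈ S, ∃ f : M ⟶ X, Epi f}

/-- `f : A ⟶ M` is a left `S`-approximation of `A`. -/
def IsLeftApprox (S : Set 𝒟) {A M : 𝒟} (f : A ⟶ M) : Prop :=
  M ∈ S ∧ ∀ M' ∈ S, ∀ g : A ⟶ M', ∃ h : M ⟶ M', f ≫ h = g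

/-- `f : M ⟶ A` is a right `S`-approximation of `A`. -/
def IsRightApprox (S : Set 𝒟) {M A : 𝒟} (f : M ⟶ A) : Prop :=
  M ∈ S ∧ ∀ M' ∈ S, ∀ g : M' ⟶ A, ∃ h : M' ⟶ M, h ≫ f = g

/-- a contravariantly finite subcategory. -/
def ContravariantlyFinite (S : Set 𝒟) : Prop :=
  ∀ A : 𝒟, ∃ (M : 𝒟) (f : M ⟶ A), IsRightApprox S f

section Ext
variable [HasExt.{w₁} 𝒟]

/-- a weak support τ-tilting subcategory. -/
def WeakSupportTauTilting (S : Set 𝒟) : Prop :=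
  (∀ M ∈ S, ∀ L ∈ Fac S, Subsingleton (Ext M L 1)) ∧
  ∀ P : 𝒟, Projective P → ∃ (M₀ M₁ : 𝒟) (f : P ⟶ M₀) (g : M₀ ⟶ M₁),
    M₀ ∈ S ∧ M₁ ∈ S ∧ Epi g ∧ ExactAt f g ∧ IsLeftApprox S f

/-- a support τ-tilting subcategory. -/
def SupportTauTilting (S : Set 𝒟) : Prop :=
  WeakSupportTauTilting S ∧ ContravariantlyFinite S

/-- `^⊥₁ S`. -/
def perpOneLeft (S : Set 𝒟) : Set 𝒟 :=
  {A | ∀ M ∈ S, Subsingleton (Ext A M 1)}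

end Ext

/-- `S^⊥₀`. -/
def perpZeroRight (S : Set 𝒟) : Set 𝒟 :=
  {A | ∀ M ∈ S, ∀ f : M ⟶ A, f = 0}

/-- a torsion pair. -/
def TorsionPair (T F : Set 𝒟) : Prop :=
  (∀ X ∈ T, ∀ Y ∈ F, ∀ f : X ⟶ Y, f = 0) ∧
  ∀ B : 𝒟, ∃ (X Y : 𝒟) (f : X ⟶ B) (g : B ⟶ Y),
    X ∈ T ∧ Y ∈ F ∧ Mono f ∧ Epi g ∧ ExactAt f g

/-- a τ-cotorsion torsion triple. -/
def TauCotorsionTorsionTriple [HasExt.{w₁} 𝒟] (L D F : Set 𝒟) : Prop :=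
  L = perpOneLeft D ∧
  (∀ P : 𝒟, Projective P → ∃ (D₀ C₀ : 𝒟) (f : P ⟶ D₀) (g : D₀ ⟶ C₀),
    D₀ ∈ L ∩ D ∧ C₀ ∈ L ∧ Epi g ∧ ExactAt f g ∧ IsLeftApprox D f) ∧
  ContravariantlyFinite (L ∩ D) ∧ TorsionPair D F

/-- the closure under isomorphism of the image of a subcategory under a functor. -/
def imgCl {𝒟' : Type u₂} [Category.{v₂} 𝒟'] (F : 𝒟 ⥤ 𝒟') (S : Set 𝒟) : Set 𝒟' :=
  {X | ∃ Y ∈ S, Nonempty (F.obj Y ≅ X)}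

set_option linter.unusedSectionVars false

section Helpers

section Joint

variable {A : Type u₁} {B : Type u₂} {C : Type u₃}
    [Category.{v₁} A] [Category.{v₂} B] [Category.{v₃} C]
    [Abelian A] [Abelian B] [Abelian C]
    (F : B ⥤ A) (G : B ⥤ C)
    [PreservesFiniteLimits F] [PreservesFiniteColimits F]
    [PreservesFiniteLimits G] [PreservesFiniteColimits G]
    [F.Additive] [G.Additive]

theorem joint_exact (hz : ∀ X, IsZero (F.obj X) → IsZero (G.obj X) → IsZero X)
    (S : ShortComplex B) (h1 : (S.map F).Exact) (h2 : (S.map G).Exact) : S.Exact := by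
  rw [ShortComplex.exact_iff_isZero_homology] at *
  exact hz _ (h1.of_iso (S.mapHomologyIso F).symm) (h2.of_iso (S.mapHomologyIso G).symm)

theorem joint_mono (hz : ∀ X, IsZero (F.obj X) → IsZero (G.obj X) → IsZero X)
    {X Y : B} (f : X ⟶ Y) (h1 : Mono (F.map f)) (h2 : Mono (G.map f)) : Mono f := by
  let S : ShortComplex B := ShortComplex.mk (0 : X ⟶ X) f (by simp)
  have : S.Exact := joint_exact F G hz S
    (((S.map F).exact_iff_mono (F.map_zero _ _)).2 h1)
    (((S.map G).exact_iff_mono (G.map_zero _ _)).2 h2)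
  exact (S.exact_iff_mono rfl).1 this

theorem joint_epi (hz : ∀ X, IsZero (F.obj X) → IsZero (G.obj X) → IsZero X)
    {X Y : B} (f : X ⟶ Y) (h1 : Epi (F.map f)) (h2 : Epi (G.map f)) : Epi f := by
  let S : ShortComplex B := ShortComplex.mk f (0 : Y ⟶ Y) (by simp)
  have : S.Exact := joint_exact F G hz S
    (((S.map F).exact_iff_epi (F.map_zero _ _)).2 h1)
    (((S.map G).exact_iff_epi (G.map_zero _ _)).2 h2)
  exact (S.exact_iff_epi rfl).1 this

end Joint

theorem leftPerp_of_iso {A : Type u₁} [Category.{v₁} A] [Abelian A] [HasExt.{w₁} A] (S : Set A)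
    {X Y : A} (e : X ≅ Y) (h : X ∈ leftPerp S) : Y ∈ leftPerp S := by
  intro N hN i hi
  have := h N hN i hi
  refine subsingleton_of_forall_eq 0 fun x => ?_
  have h0 : (Ext.mk₀ e.hom).comp x (zero_add i) = 0 := Subsingleton.elim _ _
  have h1 : (Ext.mk₀ e.inv).comp ((Ext.mk₀ e.hom).comp x (zero_add i)) (zero_add i) = x := by
    rw [Ext.mk₀_comp_mk₀_assoc]; simp
  rw [← h1, h0, Ext.comp_zero]

theorem ext_adj {A : Type u₁} {B : Type u₂} [Category.{v₁} A] [Category.{v₂} B]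
    [Abelian A] [Abelian B] [EnoughProjectives A] [HasExt.{w₁} A] [HasExt.{w₂} B]
    {F : A ⥤ B} {G : B ⥤ A} (adj : F ⊣ G) [F.Additive] [G.PreservesEpimorphisms]
    (hF : ∀ S : ShortComplex A, S.ShortExact → (S.map F).ShortExact)
    (Y : B) (n : ℕ) : ∀ X : A, Subsingleton (Ext X (G.obj Y) (n + 1)) →
      Subsingleton (Ext (F.obj X) Y (n + 1)) := by
  induction n with
  | zero =>
    intro X hX
    let S : ShortComplex A := ShortComplex.mk (kernel.ι (Projective.π X)) (Projective.π X) (by simp)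
    have hS : S.ShortExact :=
      { exact := ShortComplex.exact_kernel _, mono_f := inferInstanceAs (Mono (kernel.ι _))
        epi_g := inferInstanceAs (Epi (Projective.π X)) }
    have hP : Projective (F.obj S.X₂) := adj.map_projective _ (inferInstanceAs (Projective (Projective.over X)))
    refine subsingleton_of_forall_eq 0 fun x => ?_
    obtain ⟨y, hy⟩ := Ext.contravariant_sequence_exact₃ (hF S hS) Y x
      (Ext.eq_zero_of_projective (P := F.obj S.X₂) _) (n₀ := 0) (by simp)
    obtain ⟨g, rfl⟩ := Ext.addEquiv₀.symm.surjective y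
    obtain ⟨z, hz⟩ := Ext.contravariant_sequence_exact₁ hS (G.obj Y)
      (Ext.mk₀ (adj.homEquiv _ _ g)) (n₁ := 1) (by simp) (Subsingleton.elim (α := Ext X (G.obj Y) (0 + 1)) _ _)
    obtain ⟨k, rfl⟩ := Ext.addEquiv₀.symm.surjective z
    simp only [Ext.addEquiv₀_symm_apply, Ext.mk₀_comp_mk₀] at hz hy
    have hz' : S.f ≫ k = adj.homEquiv _ _ g := Ext.addEquiv₀.symm.injective (by simpa using hz)
    obtain ⟨k', hk⟩ : ∃ k' : (S.map F).X₂ ⟶ Y, (S.map F).f ≫ k' = g := by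
      refine ⟨(adj.homEquiv _ _).symm k, ?_⟩
      apply (adj.homEquiv _ _).injective
      rw [← hz']
      exact (adj.homEquiv_naturality_left S.f _).trans (by rw [Equiv.apply_symm_apply])
    rw [← hy, ← hk, ← Ext.mk₀_comp_mk₀, ShortComplex.ShortExact.extClass_comp_assoc]
    rfl
  | succ n ih =>
    intro X hX
    let S : ShortComplex A := ShortComplex.mk (kernel.ι (Projective.π X)) (Projective.π X) (by simp)
    have hS : S.ShortExact :=
      { exact := ShortComplex.exact_kernel _, mono_f := inferInstanceAs (Mono (kernel.ι _))
        epi_g := inferInstanceAs (Epi (Projective.π X)) }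
    have hP' : Projective S.X₂ := inferInstanceAs (Projective (Projective.over X))
    have hP : Projective (F.obj S.X₂) := adj.map_projective _ hP'
    have hK : Subsingleton (Ext S.X₁ (G.obj Y) (n + 1)) := by
      refine subsingleton_of_forall_eq 0 fun x => ?_
      obtain ⟨z, hz⟩ := Ext.contravariant_sequence_exact₁ hS (G.obj Y) x
        (n₁ := n + 1 + 1) (by omega) (Subsingleton.elim (α := Ext X (G.obj Y) (n + 1 + 1)) _ _)
      rw [← hz, Ext.eq_zero_of_projective z, Ext.comp_zero]
    have : Subsingleton (Ext (S.map F).X₁ Y (n + 1)) := ih _ hK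
    refine subsingleton_of_forall_eq 0 fun x => ?_
    obtain ⟨y, hy⟩ := Ext.contravariant_sequence_exact₃ (hF S hS) Y x
      (Ext.eq_zero_of_projective (P := F.obj S.X₂) _) (n₀ := n + 1) (by omega)
    rw [← hy, Subsingleton.elim y 0, Ext.comp_zero]
    rfl

theorem leftPerp_of_shortExact {B : Type u₂} [Category.{v₂} B] [Abelian B] [HasExt.{w₂} B]
    (S : ShortComplex B) (hS : S.ShortExact) (T : Set B) (h1 : S.X₁ ∈ leftPerp T)
    (h3 : S.X₃ ∈ leftPerp T) : S.X₂ ∈ leftPerp T := by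
  intro N hN i hi
  have := h1 N hN i hi
  have := h3 N hN i hi
  refine subsingleton_of_forall_eq 0 fun x => ?_
  obtain ⟨y, hy⟩ := Ext.contravariant_sequence_exact₂ hS N x (Subsingleton.elim _ _)
  rw [← hy, Subsingleton.elim y 0, Ext.comp_zero]

section Rec

variable {𝒜 : Type u₁} {ℬ : Type u₂} {𝒞 : Type u₃}
    [Category.{v₁} 𝒜] [Category.{v₂} ℬ] [Category.{v₃} 𝒞]
    [Abelian 𝒜] [Abelian ℬ] [Abelian 𝒞] (R : Recollement 𝒜 ℬ 𝒞)

namespace Recollement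

theorem exact_iStar : PreservesFiniteLimits R.iStar ∧ PreservesFiniteColimits R.iStar :=
  ⟨have := R.adj₁.rightAdjoint_preservesLimits; inferInstance,
   have := R.adj₂.leftAdjoint_preservesColimits; inferInstance⟩

theorem exact_jUS : PreservesFiniteLimits R.jUS ∧ PreservesFiniteColimits R.jUS :=
  ⟨have := R.adj₃.rightAdjoint_preservesLimits; inferInstance,
   have := R.adj₄.leftAdjoint_preservesColimits; inferInstance⟩

theorem jUS_iStar (A : 𝒜) : IsZero (R.jUS.obj (R.iStar.obj A)) :=
  (R.essImage_iStar _).1 (R.iStar.obj_mem_essImage A)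

theorem iUS_jLE (X : 𝒞) : IsZero (R.iUS.obj (R.jLE.obj X)) := by
  rw [IsZero.iff_id_eq_zero]
  apply (R.adj₁.homEquiv _ _).injective
  apply (R.adj₃.homEquiv _ _).injective
  exact (R.jUS_iStar _).eq_of_tgt _ _

theorem iUE_jLS (X : 𝒞) : IsZero (R.iUE.obj (R.jLS.obj X)) := by
  rw [IsZero.iff_id_eq_zero]
  apply (R.adj₂.homEquiv _ _).symm.injective
  apply (R.adj₄.homEquiv _ _).symm.injective
  exact (R.jUS_iStar _).eq_of_src _ _

theorem hz_iUS (X : ℬ) (h1 : IsZero (R.iUS.obj X)) (h2 : IsZero (R.jUS.obj X)) : IsZero X := by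
  obtain ⟨A, ⟨e⟩⟩ := (R.essImage_iStar X).2 h2
  have := R.iStar_full
  have := R.iStar_faithful
  have hA : IsZero A := h1.of_iso ((asIso (R.adj₁.counit.app A)).symm ≪≫ R.iUS.mapIso e)
  have := R.exact_iStar.1
  exact (R.iStar.map_isZero hA).of_iso e.symm

theorem hz_iUE (X : ℬ) (h1 : IsZero (R.iUE.obj X)) (h2 : IsZero (R.jUS.obj X)) : IsZero X := by
  obtain ⟨A, ⟨e⟩⟩ := (R.essImage_iStar X).2 h2
  have := R.iStar_full
  have := R.iStar_faithful
  have hA : IsZero A := h1.of_iso (asIso (R.adj₂.unit.app A) ≪≫ R.iUE.mapIso e)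
  have := R.exact_iStar.1
  exact (R.iStar.map_isZero hA).of_iso e.symm

end Recollement

theorem additive_of_preservesFiniteLimits {A : Type u₁} {B : Type u₂} [Category.{v₁} A]
    [Category.{v₂} B] [Abelian A] [Abelian B] (F : A ⥤ B) [PreservesFiniteLimits F] :
    F.Additive :=
  Functor.additive_of_preserves_binary_products F

end Rec

section Rec2

variable {𝒜 : Type u₁} {ℬ : Type u₂} {𝒞 : Type u₃}
    [Category.{v₁} 𝒜] [Category.{v₂} ℬ] [Category.{v₃} 𝒞]
    [Abelian 𝒜] [Abelian ℬ] [Abelian 𝒞] (R : Recollement 𝒜 ℬ 𝒞)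
    [PreservesFiniteLimits R.iUE] [PreservesFiniteColimits R.iUE]
    [PreservesFiniteLimits R.iUS] [PreservesFiniteColimits R.iUS]

namespace Recollement

theorem epi_unit₁ (X : ℬ) : Epi (R.adj₁.unit.app X) := by
  have := R.exact_jUS.1
  have := R.exact_jUS.2
  have := R.iStar_full
  have := R.iStar_faithful
  have := additive_of_preservesFiniteLimits R.iUS
  have := additive_of_preservesFiniteLimits R.jUS
  refine joint_epi R.iUS R.jUS R.hz_iUS _ ?_ ?_
  · infer_instance
  · exact ⟨fun g h _ => (R.jUS_iStar _).eq_of_src _ _⟩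

theorem iUS_zero_of_iUE_zero (X : ℬ) (h : IsZero (R.iUE.obj X)) : IsZero (R.iUS.obj X) := by
  have := R.epi_unit₁ X
  have := R.iStar_full
  have := R.iStar_faithful
  have h2 : IsZero (R.iUE.obj (R.iStar.obj (R.iUS.obj X))) :=
    IsZero.of_epi (R.iUE.map (R.adj₁.unit.app X)) h
  exact h2.of_iso (asIso (R.adj₂.unit.app _))

theorem iUS_jLS (X : 𝒞) : IsZero (R.iUS.obj (R.jLS.obj X)) :=
  R.iUS_zero_of_iUE_zero _ (R.iUE_jLS X)

theorem iso_iUS_iUE (X : ℬ) : Nonempty (R.iUS.obj X ≅ R.iUE.obj X) := by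
  have := R.exact_jUS.1
  have := R.exact_jUS.2
  have := R.iStar_full
  have := R.iStar_faithful
  have := additive_of_preservesFiniteLimits R.iUS
  have := additive_of_preservesFiniteLimits R.iUE
  have := additive_of_preservesFiniteLimits R.jUS
  let c := R.adj₂.counit.app X
  have hm : Mono c := by
    refine joint_mono R.iUE R.jUS R.hz_iUE _ ?_ ?_
    · infer_instance
    · exact ⟨fun g h _ => (R.jUS_iStar _).eq_of_tgt _ _⟩
  let S : ShortComplex ℬ := ShortComplex.mk c (cokernel.π c) (by simp)
  have hS : S.ShortExact :=
    { exact := ShortComplex.exact_cokernel _, mono_f := hm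
      epi_g := inferInstanceAs (Epi (cokernel.π c)) }
  have h1 := hS.map_of_exact R.iUE
  have z1 : IsZero (R.iUE.obj (cokernel c)) :=
    h1.isIso_f_iff.1 (inferInstanceAs (IsIso (R.iUE.map (R.adj₂.counit.app X))))
  have z2 := R.iUS_zero_of_iUE_zero _ z1
  have : IsIso (R.iUS.map c) := (hS.map_of_exact R.iUS).isIso_f_iff.2 z2
  exact ⟨(asIso (R.iUS.map c)).symm ≪≫ asIso (R.adj₁.counit.app _)⟩

theorem shortExact_jLE (S : ShortComplex 𝒞) (hS : S.ShortExact) [R.jLE.PreservesZeroMorphisms] :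
    (S.map R.jLE).ShortExact := by
  have := R.exact_jUS.1
  have := R.exact_jUS.2
  have := R.jLE_full
  have := R.jLE_faithful
  have := additive_of_preservesFiniteLimits R.iUS
  have := additive_of_preservesFiniteLimits R.jUS
  have hS' := hS
  obtain ⟨he, hm, hp⟩ := hS'
  have hiso : S ≅ (S.map R.jLE).map R.jUS :=
    let u (X : 𝒞) : X ≅ R.jUS.obj (R.jLE.obj X) := asIso (R.adj₃.unit.app X)
    ShortComplex.isoMk (u S.X₁) (u S.X₂) (u S.X₃) (R.adj₃.unit.naturality S.f).symm
      (R.adj₃.unit.naturality S.g).symm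
  have h2 := (ShortComplex.shortExact_iff_of_iso hiso).1 hS
  have m2 := h2.mono_f
  have p2 := h2.epi_g
  refine ShortComplex.ShortExact.mk' ?_ ?_ ?_
  · refine joint_exact R.iUS R.jUS R.hz_iUS _ ?_ h2.exact
    exact ShortComplex.exact_of_isZero_X₂ _ (R.iUS_jLE _)
  · exact joint_mono R.iUS R.jUS R.hz_iUS _ ⟨fun g h _ => (R.iUS_jLE _).eq_of_tgt _ _⟩ m2
  · exact joint_epi R.iUS R.jUS R.hz_iUS _ ⟨fun g h _ => (R.iUS_jLE _).eq_of_src _ _⟩ p2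

theorem can_zero (X : ℬ) : R.adj₃.counit.app X ≫ R.adj₁.unit.app X = 0 := by
  apply (R.adj₃.homEquiv _ _).injective
  exact (R.jUS_iStar _).eq_of_tgt _ _

theorem can_shortExact (X : ℬ) :
    (ShortComplex.mk (R.adj₃.counit.app X) (R.adj₁.unit.app X) (R.can_zero X)).ShortExact := by
  have := R.exact_jUS.1
  have := R.exact_jUS.2
  have := R.jLE_full
  have := R.jLE_faithful
  have := R.iStar_full
  have := R.iStar_faithful
  have := additive_of_preservesFiniteLimits R.iUS
  have := additive_of_preservesFiniteLimits R.jUS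
  refine ShortComplex.ShortExact.mk' ?_ ?_ (R.epi_unit₁ X)
  · refine joint_exact R.iUS R.jUS R.hz_iUS _ ?_ ?_
    · exact (ShortComplex.exact_iff_mono _ ((R.iUS_jLE _).eq_of_src _ _)).2
        (inferInstanceAs (Mono (R.iUS.map (R.adj₁.unit.app X))))
    · exact (ShortComplex.exact_iff_epi _ ((R.jUS_iStar _).eq_of_tgt _ _)).2
        (inferInstanceAs (Epi (R.jUS.map (R.adj₃.counit.app X))))
  · exact joint_mono R.iUS R.jUS R.hz_iUS _ ⟨fun g h _ => (R.iUS_jLE _).eq_of_tgt _ _⟩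
      (inferInstanceAs (Mono (R.jUS.map (R.adj₃.counit.app X))))

theorem mem_leftPerp [EnoughProjectives 𝒜] [EnoughProjectives 𝒞]
    [HasExt.{w₁} 𝒜] [HasExt.{w₂} ℬ] [HasExt.{w₃} 𝒞] (𝒳' : Set 𝒜) (𝒳'' : Set 𝒞) (X : ℬ)
    (h1 : R.iUS.obj X ∈ leftPerp 𝒳') (h2 : R.jUS.obj X ∈ leftPerp 𝒳'') :
    X ∈ leftPerp {X : ℬ | R.iUE.obj X ∈ 𝒳' ∧ R.jUS.obj X ∈ 𝒳''} := by
  have := R.exact_jUS.1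
  have := R.exact_jUS.2
  have := R.exact_iStar.1
  have := R.exact_iStar.2
  have := additive_of_preservesFiniteLimits R.iStar
  have := additive_of_preservesFiniteLimits R.jUS
  have := R.adj₃.left_adjoint_additive
  refine leftPerp_of_shortExact _ (R.can_shortExact X) _ ?_ ?_
  · rintro N ⟨_, hN⟩ i hi
    obtain ⟨n, rfl⟩ := Nat.exists_eq_add_of_le' hi
    exact ext_adj R.adj₃ (fun S hS => R.shortExact_jLE S hS) N n _ (h2 _ hN _ hi)
  · rintro N ⟨hN, _⟩ i hi
    obtain ⟨n, rfl⟩ := Nat.exists_eq_add_of_le' hi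
    exact ext_adj R.adj₂ (fun S hS => hS.map_of_exact R.iStar) N n _ (h1 _ hN _ hi)

/-- the canonical iso `i^* (i_* A ⊞ j_* C) ≅ A`. -/
theorem isIso_alpha (A : 𝒜) (C : 𝒞) :
    IsIso (R.iUS.map (biprod.fst : R.iStar.obj A ⊞ R.jLS.obj C ⟶ _) ≫ R.adj₁.counit.app A) := by
  have := R.iStar_full
  have := R.iStar_faithful
  have := additive_of_preservesFiniteLimits R.iUS
  have : IsIso (R.iUS.map (biprod.fst : R.iStar.obj A ⊞ R.jLS.obj C ⟶ _)) := by
    refine ⟨R.iUS.map biprod.inl, ?_, ?_⟩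
    · have h0 : R.iUS.map (biprod.snd : R.iStar.obj A ⊞ R.jLS.obj C ⟶ _) = 0 :=
        (R.iUS_jLS _).eq_of_tgt _ _
      rw [← R.iUS.map_id, ← biprod.total, R.iUS.map_add, R.iUS.map_comp biprod.snd, h0, zero_comp,
        add_zero, R.iUS.map_comp]
    · rw [← R.iUS.map_comp, biprod.inl_fst, R.iUS.map_id]
  infer_instance

theorem isIso_beta (A : 𝒜) (C : 𝒞) :
    IsIso (R.jUS.map (biprod.snd : R.iStar.obj A ⊞ R.jLS.obj C ⟶ _) ≫ R.adj₄.counit.app C) := by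
  have := R.exact_jUS.1
  have := R.jLS_full
  have := R.jLS_faithful
  have := additive_of_preservesFiniteLimits R.jUS
  have : IsIso (R.jUS.map (biprod.snd : R.iStar.obj A ⊞ R.jLS.obj C ⟶ _)) := by
    refine ⟨R.jUS.map biprod.inr, ?_, ?_⟩
    · have h0 : R.jUS.map (biprod.fst : R.iStar.obj A ⊞ R.jLS.obj C ⟶ _) = 0 :=
        (R.jUS_iStar _).eq_of_tgt _ _
      rw [← R.jUS.map_id, ← biprod.total, R.jUS.map_add, R.jUS.map_comp biprod.fst, h0, zero_comp,
        zero_add, R.jUS.map_comp]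
    · rw [← R.jUS.map_comp, biprod.inr_snd, R.jUS.map_id]
  infer_instance

end Recollement

end Rec2

end Helpers

/-- If `(𝒜, ℬ, 𝒞)` is a recollement of abelian categories, `𝒳'` and `𝒳''` are wakamatsu
tilting subcategories of `𝒜` and `𝒞`, and `i^!`, `i^*` are exact, then
`𝒳 = {X ∈ ℬ | i^!(X) ∈ 𝒳', j^*(X) ∈ 𝒳''}` is a wakamatsu tilting subcategory of `ℬ`. -/
theorem stmt_0
    {𝒜 : Type u₁} {ℬ : Type u₂} {𝒞 : Type u₃}
    [Category.{v₁} 𝒜] [Category.{v₂} ℬ] [Category.{v₃} 𝒞]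
    [Abelian 𝒜] [Abelian ℬ] [Abelian 𝒞]
    [EnoughProjectives 𝒜] [EnoughInjectives 𝒜]
    [EnoughProjectives ℬ] [EnoughInjectives ℬ]
    [EnoughProjectives 𝒞] [EnoughInjectives 𝒞]
    [HasExt.{w₁} 𝒜] [HasExt.{w₂} ℬ] [HasExt.{w₃} 𝒞]
    (R : Recollement 𝒜 ℬ 𝒞)
    (𝒳' : Set 𝒜) (𝒳'' : Set 𝒞)
    (good' : IsGoodSubcat 𝒳') (good'' : IsGoodSubcat 𝒳'')
    (h' : WakamatsuTilting 𝒳') (h'' : WakamatsuTilting 𝒳'')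
    [PreservesFiniteLimits R.iUE] [PreservesFiniteColimits R.iUE]
    [PreservesFiniteLimits R.iUS] [PreservesFiniteColimits R.iUS] :
    WakamatsuTilting {X : ℬ | R.iUE.obj X ∈ 𝒳' ∧ R.jUS.obj X ∈ 𝒳''} := by
  have := R.exact_jUS.1
  have := R.exact_jUS.2
  have := R.exact_iStar.1
  have := R.exact_iStar.2
  have := additive_of_preservesFiniteLimits R.iStar
  have := additive_of_preservesFiniteLimits R.jUS
  have := additive_of_preservesFiniteLimits R.iUS
  have := R.adj₄.right_adjoint_additive
  constructor
  · rintro M ⟨hM1, hM2⟩ N hN i hi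
    obtain ⟨e⟩ := R.iso_iUS_iUE M
    refine R.mem_leftPerp 𝒳' 𝒳'' M ?_ (h''.1 _ hM2) N hN i hi
    exact leftPerp_of_iso _ e.symm (h'.1 _ hM1)
  intro P hP
  have hepi : R.jLS.PreservesEpimorphisms := by
    refine ⟨fun {X Y} f hf => ?_⟩
    have := R.jLS_full
    have := R.jLS_faithful
    refine joint_epi R.iUS R.jUS R.hz_iUS _ ⟨fun g h _ => (R.iUS_jLS _).eq_of_src _ _⟩ ?_
    have h1 := R.adj₄.counit.naturality f
    have h2 : R.jUS.map (R.jLS.map f) = R.adj₄.counit.app X ≫ f ≫ inv (R.adj₄.counit.app Y) := by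
      rw [← Category.assoc, IsIso.eq_comp_inv]
      exact h1
    rw [h2]
    infer_instance
  obtain ⟨-, W', f', d', hW', hm', he', hd', hi'⟩ := h'.2 _ (R.adj₁.map_projective P hP)
  obtain ⟨-, W'', f'', d'', hW'', hm'', he'', hd'', hi''⟩ := h''.2 _ (R.adj₄.map_projective P hP)
  let W : ℕ → ℬ := fun n => R.iStar.obj (W' n) ⊞ R.jLS.obj (W'' n)
  let f : P ⟶ W 0 := biprod.lift (R.adj₁.homEquiv _ _ f') (R.adj₄.homEquiv _ _ f'')
  let d : ∀ n, W n ⟶ W (n + 1) := fun n => biprod.map (R.iStar.map (d' n)) (R.jLS.map (d'' n))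
  let α : ∀ n, R.iUS.obj (W n) ≅ W' n := fun n =>
    have := R.isIso_alpha (W' n) (W'' n)
    asIso (R.iUS.map biprod.fst ≫ R.adj₁.counit.app (W' n))
  let β : ∀ n, R.jUS.obj (W n) ≅ W'' n := fun n =>
    have := R.isIso_beta (W' n) (W'' n)
    asIso (R.jUS.map biprod.snd ≫ R.adj₄.counit.app (W'' n))
  have hα : ∀ n, (α n).hom = R.iUS.map biprod.fst ≫ R.adj₁.counit.app (W' n) := fun n => rfl
  have hβ : ∀ n, (β n).hom = R.jUS.map biprod.snd ≫ R.adj₄.counit.app (W'' n) := fun n => rfl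
  have hfα : R.iUS.map f ≫ (α 0).hom = f' := by
    rw [hα, ← R.iUS.map_comp_assoc]
    simp only [f, biprod.lift_fst]
    rw [← R.adj₁.homEquiv_counit, Equiv.symm_apply_apply]
  have hfβ : R.jUS.map f ≫ (β 0).hom = f'' := by
    rw [hβ, ← R.jUS.map_comp_assoc]
    simp only [f, biprod.lift_snd]
    rw [← R.adj₄.homEquiv_counit, Equiv.symm_apply_apply]
  have hdα : ∀ n, R.iUS.map (d n) ≫ (α (n + 1)).hom = (α n).hom ≫ d' n := by
    intro n
    rw [hα, hα, ← R.iUS.map_comp_assoc]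
    simp only [d, biprod.map_fst]
    simp
  have hdβ : ∀ n, R.jUS.map (d n) ≫ (β (n + 1)).hom = (β n).hom ≫ d'' n := by
    intro n
    rw [hβ, hβ, ← R.jUS.map_comp_assoc]
    simp only [d, biprod.map_snd]
    simp
  refine ⟨?_, W, f, d, ?_, ?_, ?_, ?_, ?_⟩
  · rintro N - i hi
    obtain ⟨n, rfl⟩ := Nat.exists_eq_add_of_le' hi
    exact Ext.subsingleton_of_projective _ _ _
  · intro n
    obtain ⟨e⟩ := R.iso_iUS_iUE (W n)
    exact ⟨good'.1 ((α n).symm ≪≫ e) (hW' n), good''.1 (β n).symm (hW'' n)⟩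
  · refine joint_mono R.iUS R.jUS R.hz_iUS _ ?_ ?_
    · rw [← hfα] at hm'
      exact mono_of_mono _ (α 0).hom
    · rw [← hfβ] at hm''
      exact mono_of_mono _ (β 0).hom
  · obtain ⟨w', e'⟩ := he'
    obtain ⟨w'', e''⟩ := he''
    have w : f ≫ d 0 = 0 := by
      simp only [f, d]
      ext
      · simp [← Functor.map_comp, w', Adjunction.homEquiv_unit]
      · simp [← Functor.map_comp, w'', Adjunction.homEquiv_unit]
    refine ⟨w, joint_exact R.iUS R.jUS R.hz_iUS _ ?_ ?_⟩
    · refine (ShortComplex.exact_iff_of_iso ?_).2 e'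
      exact ShortComplex.isoMk (Iso.refl _) (α 0) (α 1) ((Category.id_comp _).trans hfα.symm) (hdα 0).symm
    · refine (ShortComplex.exact_iff_of_iso ?_).2 e''
      exact ShortComplex.isoMk (Iso.refl _) (β 0) (β 1) ((Category.id_comp _).trans hfβ.symm) (hdβ 0).symm
  · intro n
    obtain ⟨w', e'⟩ := hd' n
    obtain ⟨w'', e''⟩ := hd'' n
    have w : d n ≫ d (n + 1) = 0 := by
      simp only [d]
      ext <;> simp [← Functor.map_comp_assoc, w', w'']
    refine ⟨w, joint_exact R.iUS R.jUS R.hz_iUS _ ?_ ?_⟩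
    · refine (ShortComplex.exact_iff_of_iso ?_).2 e'
      exact ShortComplex.isoMk (α n) (α (n + 1)) (α (n + 2)) (hdα n).symm (hdα (n + 1)).symm
    · refine (ShortComplex.exact_iff_of_iso ?_).2 e''
      exact ShortComplex.isoMk (β n) (β (n + 1)) (β (n + 2)) (hdβ n).symm (hdβ (n + 1)).symm
  · intro n
    refine R.mem_leftPerp 𝒳' 𝒳'' _ ?_ ?_
    · refine leftPerp_of_iso _ ?_ (hi' n)
      exact (Limits.im.mapIso (Arrow.isoMk (f := Arrow.mk (R.iUS.map (d n))) (g := Arrow.mk (d' n))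
        (α n) (α (n + 1)) (hdα n).symm)).symm ≪≫ PreservesImage.iso R.iUS (d n)
    · refine leftPerp_of_iso _ ?_ (hi'' n)
      exact (Limits.im.mapIso (Arrow.isoMk (f := Arrow.mk (R.jUS.map (d n))) (g := Arrow.mk (d'' n))
        (β n) (β (n + 1)) (hdβ n).symm)).symm ≪≫ PreservesImage.iso R.jUS (d n)
end

section
/- Let (𝒜, ℬ, 𝒞) be a recollement of abelian categories and let 𝒴 be a self-orthogonal subcategory of ℬ. If i^! is exact, i_* i^!(𝒴) ⊆ 𝒴, and j_* j^*(𝒴) ⊆ 𝒴, then i^!(𝒴) and j^*(𝒴) are self-orthogonal subcategories of 𝒜 and 𝒞, respectively. -/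
open CategoryTheory Limits Abelian

universe w₁ w₂ w₃ v₁ v₂ v₃ u₁ u₂ u₃

variable {𝒟 : Type u₁} [Category.{v₁} 𝒟] [Abelian 𝒟]

section Helpers

theorem ext_one_subsingleton_iff {C : Type u₁} [Category.{v₁} C] [Abelian C] [HasExt.{w₁} C]
    {S : ShortComplex C} (hS : S.ShortExact) [Injective S.X₂] (X : C) :
    Subsingleton (Ext X S.X₁ 1) ↔ ∀ f : X ⟶ S.X₃, ∃ g : X ⟶ S.X₂, g ≫ S.g = f := by
  constructor
  · intro h f
    obtain ⟨x, hx⟩ := Ext.covariant_sequence_exact₃ X hS (Ext.mk₀ f) (zero_add 1)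
      (Subsingleton.elim _ _)
    obtain ⟨g, rfl⟩ := (Ext.mk₀_bijective X S.X₂).2 x
    rw [Ext.mk₀_comp_mk₀] at hx
    exact ⟨g, (Ext.mk₀_bijective _ _).1 hx⟩
  · intro h
    refine subsingleton_of_forall_eq 0 fun x => ?_
    obtain ⟨y, rfl⟩ := Ext.covariant_sequence_exact₁ X hS x (Ext.eq_zero_of_injective _)
      (zero_add 1)
    obtain ⟨f, rfl⟩ := (Ext.mk₀_bijective X S.X₃).2 y
    obtain ⟨g, rfl⟩ := h f
    rw [← Ext.mk₀_comp_mk₀, Ext.comp_assoc_of_second_deg_zero, hS.comp_extClass, Ext.comp_zero]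

theorem ext_succ_subsingleton_iff {C : Type u₁} [Category.{v₁} C] [Abelian C] [HasExt.{w₁} C]
    {S : ShortComplex C} (hS : S.ShortExact) [Injective S.X₂] (X : C) (n : ℕ) :
    Subsingleton (Ext X S.X₁ (n + 2)) ↔ Subsingleton (Ext X S.X₃ (n + 1)) := by
  constructor
  · intro h
    refine subsingleton_of_forall_eq 0 fun x => ?_
    obtain ⟨y, rfl⟩ := Ext.covariant_sequence_exact₃ X hS x (n₁ := n + 2) rfl
      (Subsingleton.elim _ _)
    rw [Ext.eq_zero_of_injective y, Ext.zero_comp]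
  · intro h
    refine subsingleton_of_forall_eq 0 fun x => ?_
    obtain ⟨y, rfl⟩ := Ext.covariant_sequence_exact₁ X hS x (Ext.eq_zero_of_injective _)
      (n₀ := n + 1) rfl
    rw [Subsingleton.elim y 0, Ext.zero_comp]

theorem ext_adj_iff {C : Type u₁} {D : Type u₂} [Category.{v₁} C] [Category.{v₂} D]
    [Abelian C] [Abelian D] [HasExt.{w₁} C] [HasExt.{w₂} D] [EnoughInjectives D]
    {F : C ⥤ D} {G : D ⥤ C} (adj : F ⊣ G) [F.PreservesMonomorphisms] [G.PreservesEpimorphisms]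
    (X : C) (n : ℕ) : ∀ Y : D,
    Subsingleton (Ext (F.obj X) Y (n + 1)) ↔ Subsingleton (Ext X (G.obj Y) (n + 1)) := by
  have : PreservesLimitsOfSize.{0, 0} G := adj.rightAdjoint_preservesLimits
  have : G.Additive := G.additive_of_preserves_binary_products
  have key : ∀ Y : D, ∃ (S : ShortComplex D), S.X₁ = Y ∧ S.ShortExact ∧ Injective S.X₂ ∧
      (S.map G).ShortExact ∧ Injective (S.map G).X₂ := by
    intro Y
    obtain ⟨P⟩ := EnoughInjectives.presentation Y
    let S : ShortComplex D := ShortComplex.mk P.f (cokernel.π P.f) (by simp)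
    have hS : S.ShortExact :=
      { exact := ShortComplex.exact_of_g_is_cokernel _ (cokernelIsCokernel P.f)
        mono_f := P.mono
        epi_g := inferInstanceAs (Epi (cokernel.π P.f)) }
    have h : (S.map G).Exact ∧ Mono (G.map S.f) :=
      ((Functor.preservesFiniteLimits_tfae G).out 3 0 :).1
        (inferInstance : PreservesFiniteLimits G) S hS
    have := hS.epi_g
    refine ⟨S, rfl, hS, P.injective,
      { exact := h.1, mono_f := h.2, epi_g := inferInstanceAs (Epi (G.map S.g)) }, ?_⟩
    exact Injective.injective_of_adjoint adj P.J
  induction n with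
  | zero =>
    intro Y
    obtain ⟨S, rfl, hS, _, hGS, _⟩ := key Y
    refine (ext_one_subsingleton_iff hS _).trans
      (Iff.trans ?_ (ext_one_subsingleton_iff hGS X).symm)
    constructor
    · intro h f
      obtain ⟨g, hg⟩ := h ((adj.homEquiv _ _).symm f)
      refine ⟨adj.homEquiv _ _ g, ?_⟩
      have := adj.homEquiv_naturality_right g S.g
      rw [hg] at this
      exact this.symm.trans ((adj.homEquiv X S.X₃).apply_symm_apply f)
    · intro h f
      obtain ⟨g, hg⟩ := h (adj.homEquiv _ _ f)
      refine ⟨(adj.homEquiv _ _).symm g, ?_⟩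
      have := adj.homEquiv_naturality_right_symm g S.g
      rw [← this, Equiv.symm_apply_eq]
      exact hg
  | succ n ih =>
    intro Y
    obtain ⟨S, rfl, hS, _, hGS, _⟩ := key Y
    exact (ext_succ_subsingleton_iff hS _ n).trans
      ((ih _).trans (ext_succ_subsingleton_iff hGS X n).symm)

theorem ext_subsingleton_of_iso {C : Type u₁} [Category.{v₁} C] [Abelian C] [HasExt.{w₁} C]
    {X X' Y Y' : C} (e : X ≅ X') (e' : Y ≅ Y') (n : ℕ) (h : Subsingleton (Ext X Y n)) :
    Subsingleton (Ext X' Y' n) := by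
  refine subsingleton_of_forall_eq 0 fun x => ?_
  have h1 : (Ext.mk₀ e.hom).comp (x.comp (Ext.mk₀ e'.inv) (add_zero n)) (zero_add n) = 0 :=
    Subsingleton.elim _ _
  have h2 := congrArg (fun y => (Ext.mk₀ e.inv).comp y (zero_add n)) h1
  simp only [Ext.mk₀_comp_mk₀_assoc, Iso.inv_hom_id, Ext.mk₀_id_comp, Ext.comp_zero] at h2
  have h3 := congrArg (fun y => y.comp (Ext.mk₀ e'.hom) (add_zero n)) h2
  simpa [Ext.comp_assoc_of_third_deg_zero, Ext.mk₀_comp_mk₀] using h3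

theorem jLS_preservesEpi {𝒜 : Type u₁} {ℬ : Type u₂} {𝒞 : Type u₃}
    [Category.{v₁} 𝒜] [Category.{v₂} ℬ] [Category.{v₃} 𝒞]
    [Abelian 𝒜] [Abelian ℬ] [Abelian 𝒞] (R : Recollement 𝒜 ℬ 𝒞)
    [R.iUE.PreservesEpimorphisms] : R.jLS.PreservesEpimorphisms := by
  refine ⟨fun {X Y} f hf => ?_⟩
  have := R.jLS_full
  have := R.jLS_faithful
  have : PreservesColimitsOfSize.{0, 0} R.jUS := R.adj₄.leftAdjoint_preservesColimits
  -- `i^! j_* = 0`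
  have hz : IsZero (R.iUE.obj (R.jLS.obj Y)) := by
    have h0 : IsZero (R.jUS.obj (R.iStar.obj (R.iUE.obj (R.jLS.obj Y)))) :=
      (R.essImage_iStar _).1 (R.iStar.obj_mem_essImage _)
    rw [IsZero.iff_id_eq_zero]
    apply (R.adj₂.homEquiv _ _).symm.injective
    apply (R.adj₄.homEquiv _ _).symm.injective
    exact h0.eq_of_src _ _
  let p := cokernel.π (R.jLS.map f)
  have hp : R.jUS.map p = 0 := by
    have hepi : Epi (R.jUS.map (R.jLS.map f)) := by
      have e := R.adj₄.counit.naturality f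
      have : R.jUS.map (R.jLS.map f) =
          R.adj₄.counit.app X ≫ f ≫ inv (R.adj₄.counit.app Y) := by
        rw [← Category.assoc, IsIso.eq_comp_inv]
        exact e
      rw [this]
      infer_instance
    have : R.jUS.map (R.jLS.map f) ≫ R.jUS.map p = R.jUS.map (R.jLS.map f) ≫ 0 := by
      rw [← Functor.map_comp, cokernel.condition, comp_zero]
      have := (R.adj₄.isLeftAdjoint)
      exact R.jUS.map_zero _ _
    exact (cancel_epi _).1 this
  have hK : IsZero (R.jUS.obj (cokernel (R.jLS.map f))) := by
    have : Epi (R.jUS.map p) := inferInstance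
    exact IsZero.of_epi_eq_zero _ hp
  obtain ⟨A, ⟨e⟩⟩ := (R.essImage_iStar _).2 hK
  have hiK : IsZero (R.iUE.obj (cokernel (R.jLS.map f))) :=
    IsZero.of_epi (R.iUE.map p) hz
  have he : e.hom = 0 := by
    apply (R.adj₂.homEquiv _ _).injective
    exact hiK.eq_of_tgt _ _
  have hc : IsZero (cokernel (R.jLS.map f)) := IsZero.of_epi_eq_zero e.hom he
  exact Preadditive.epi_of_cokernel_zero (hc.eq_of_tgt _ _)

end Helpers

/-- If `𝒴` is a self-orthogonal subcategory of `ℬ`, `i^!` is exact, `i_* i^!(𝒴) ⊆ 𝒴` and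
`j_* j^*(𝒴) ⊆ 𝒴`, then `i^!(𝒴)` and `j^*(𝒴)` are self-orthogonal subcategories of
`𝒜` and `𝒞` respectively. -/
theorem stmt_1
    {𝒜 : Type u₁} {ℬ : Type u₂} {𝒞 : Type u₃}
    [Category.{v₁} 𝒜] [Category.{v₂} ℬ] [Category.{v₃} 𝒞]
    [Abelian 𝒜] [Abelian ℬ] [Abelian 𝒞]
    [EnoughProjectives 𝒜] [EnoughInjectives 𝒜]
    [EnoughProjectives ℬ] [EnoughInjectives ℬ]
    [EnoughProjectives 𝒞] [EnoughInjectives 𝒞]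
    [HasExt.{w₁} 𝒜] [HasExt.{w₂} ℬ] [HasExt.{w₃} 𝒞]
    (R : Recollement 𝒜 ℬ 𝒞)
    (𝒴 : Set ℬ) (good : IsGoodSubcat 𝒴)
    (hso : SelfOrthogonal 𝒴)
    [PreservesFiniteLimits R.iUE] [PreservesFiniteColimits R.iUE]
    (h₁ : ∀ Y ∈ 𝒴, R.iStar.obj (R.iUE.obj Y) ∈ 𝒴)
    (h₂ : ∀ Y ∈ 𝒴, R.jLS.obj (R.jUS.obj Y) ∈ 𝒴) :
    SelfOrthogonal (imgCl R.iUE 𝒴) ∧ SelfOrthogonal (imgCl R.jUS 𝒴) := by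
  have hpe := jLS_preservesEpi R
  have hA : PreservesLimitsOfSize.{0, 0} R.iStar := R.adj₁.rightAdjoint_preservesLimits
  have hJ : PreservesLimitsOfSize.{0, 0} R.jUS := R.adj₃.rightAdjoint_preservesLimits
  constructor
  · rintro M ⟨Y, hY, ⟨e⟩⟩ N ⟨Y', hY', ⟨e'⟩⟩ i hi
    obtain ⟨n, rfl⟩ := Nat.exists_eq_add_of_le' hi
    exact ext_subsingleton_of_iso e e' _
      ((ext_adj_iff R.adj₂ _ n _).1 (hso _ (h₁ Y hY) _ hY' _ hi))
  · rintro M ⟨Y, hY, ⟨e⟩⟩ N ⟨Y', hY', ⟨e'⟩⟩ i hi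
    obtain ⟨n, rfl⟩ := Nat.exists_eq_add_of_le' hi
    exact ext_subsingleton_of_iso e e' _
      ((ext_adj_iff R.adj₄ _ n _).2 (hso _ hY _ (h₂ Y' hY') _ hi))
end

section
/- Let (𝒜, ℬ, 𝒞) be a recollement of abelian categories, and let 𝒵' and 𝒵'' be weak support τ-tilting subcategories of 𝒜 and 𝒞, respectively. If i^* and i^! are exact, then 𝒵 = {Z ∈ ℬ | i^!(Z) ∈ 𝒵' and j^*(Z) ∈ 𝒵''} is a weak support τ-tilting subcategory of ℬ. -/
open CategoryTheory Limits Abelian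

universe w₁ w₂ w₃ v₁ v₂ v₃ u₁ u₂ u₃

variable {𝒟 : Type u₁} [Category.{v₁} 𝒟] [Abelian 𝒟]

section Helpers

variable {𝒜 : Type u₁} {ℬ : Type u₂} {𝒞 : Type u₃}
    [Category.{v₁} 𝒜] [Category.{v₂} ℬ] [Category.{v₃} 𝒞]
    [Abelian 𝒜] [Abelian ℬ] [Abelian 𝒞]

/-- two functors are jointly conservative on zero objects -/
def JointZero (F : ℬ ⥤ 𝒜) (G : ℬ ⥤ 𝒞) : Prop :=
  ∀ X : ℬ, IsZero (F.obj X) → IsZero (G.obj X) → IsZero X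

lemma isZero_map_cokernel (F : ℬ ⥤ 𝒜) [F.Additive] [PreservesFiniteColimits F]
    {X Y : ℬ} (f : X ⟶ Y) (h : Epi (F.map f)) : IsZero (F.obj (cokernel f)) := by
  have : F.map (cokernel.π f) = 0 := by
    rw [← cancel_epi (F.map f), ← F.map_comp, cokernel.condition]; simp
  exact IsZero.of_epi_eq_zero _ this

lemma isZero_map_kernel (F : ℬ ⥤ 𝒜) [F.Additive] [PreservesFiniteLimits F]
    {X Y : ℬ} (f : X ⟶ Y) (h : Mono (F.map f)) : IsZero (F.obj (kernel f)) := by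
  have : F.map (kernel.ι f) = 0 := by
    rw [← cancel_mono (F.map f), ← F.map_comp, kernel.condition]; simp
  exact IsZero.of_mono_eq_zero _ this

section
variable {F : ℬ ⥤ 𝒜} {G : ℬ ⥤ 𝒞} [F.Additive] [G.Additive]

lemma JointZero.epi [PreservesFiniteColimits F] [PreservesFiniteColimits G]
    (hz : JointZero F G) {X Y : ℬ} (f : X ⟶ Y)
    (h₁ : Epi (F.map f)) (h₂ : Epi (G.map f)) : Epi f :=
  Preadditive.epi_of_isZero_cokernel f
    (hz _ (isZero_map_cokernel F f h₁) (isZero_map_cokernel G f h₂))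

lemma JointZero.mono [PreservesFiniteLimits F] [PreservesFiniteLimits G]
    (hz : JointZero F G) {X Y : ℬ} (f : X ⟶ Y)
    (h₁ : Mono (F.map f)) (h₂ : Mono (G.map f)) : Mono f :=
  Preadditive.mono_of_isZero_kernel f
    (hz _ (isZero_map_kernel F f h₁) (isZero_map_kernel G f h₂))

variable [PreservesFiniteColimits F] [PreservesFiniteColimits G]
  [PreservesFiniteLimits F] [PreservesFiniteLimits G]

lemma JointZero.isIso (hz : JointZero F G) {X Y : ℬ} (f : X ⟶ Y)
    (h₁ : IsIso (F.map f)) (h₂ : IsIso (G.map f)) : IsIso f := by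
  have := hz.mono f inferInstance inferInstance
  have := hz.epi f inferInstance inferInstance
  exact isIso_of_mono_of_epi f

lemma epi_map_kernel_of_map_eq_zero (F : ℬ ⥤ 𝒜) [F.Additive] [PreservesFiniteColimits F]
    [PreservesFiniteLimits F] {X Y : ℬ} (f : X ⟶ Y) (h : F.map f = 0) :
    Epi (F.map (kernel.ι f)) :=
  ((ShortComplex.exact_kernel f).map F).epi_f h

lemma JointZero.eq_zero (hz : JointZero F G) {X Y : ℬ} (f : X ⟶ Y)
    (h₁ : F.map f = 0) (h₂ : G.map f = 0) : f = 0 := by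
  have := hz.epi (kernel.ι f) (epi_map_kernel_of_map_eq_zero F f h₁)
    (epi_map_kernel_of_map_eq_zero G f h₂)
  rw [← cancel_epi (kernel.ι f), kernel.condition, comp_zero]

lemma JointZero.ext (hz : JointZero F G) {X Y : ℬ} {f g : X ⟶ Y}
    (h₁ : F.map f = F.map g) (h₂ : G.map f = G.map g) : f = g := by
  rw [← sub_eq_zero]
  exact hz.eq_zero _ (by simp [h₁]) (by simp [h₂])

lemma JointZero.exact (hz : JointZero F G) (S : ShortComplex ℬ)
    (h₁ : (S.map F).Exact) (h₂ : (S.map G).Exact) : S.Exact := by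
  rw [ShortComplex.exact_iff_isZero_homology] at h₁ h₂ ⊢
  exact hz _ (h₁.of_iso (S.mapHomologyIso F).symm) (h₂.of_iso (S.mapHomologyIso G).symm)

end

lemma exists_ext_of_subsingleton [HasExt.{w₁} 𝒜] {S : ShortComplex 𝒜} (hS : S.ShortExact)
    (L : 𝒜) (h : Subsingleton (Ext S.X₃ L 1)) (φ : S.X₁ ⟶ L) : ∃ ψ : S.X₂ ⟶ L, S.f ≫ ψ = φ := by
  obtain ⟨x, hx⟩ := Ext.contravariant_sequence_exact₁ hS L (Ext.mk₀ φ) (n₁ := 1) rfl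
    (Subsingleton.elim _ _)
  obtain ⟨ψ, rfl⟩ := (Ext.mk₀_bijective _ _).2 x
  refine ⟨ψ, (Ext.mk₀_bijective _ _).1 ?_⟩
  rw [← hx, Ext.mk₀_comp_mk₀]

lemma subsingleton_ext_of_exists [HasExt.{w₁} 𝒜] {S : ShortComplex 𝒜} (hS : S.ShortExact)
    [Projective S.X₂] (L : 𝒜) (h : ∀ φ : S.X₁ ⟶ L, ∃ ψ : S.X₂ ⟶ L, S.f ≫ ψ = φ) :
    Subsingleton (Ext S.X₃ L 1) := by
  refine subsingleton_of_forall_eq 0 fun x => ?_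
  obtain ⟨y, rfl⟩ := Ext.contravariant_sequence_exact₃ hS L x
    (Ext.eq_zero_of_projective _) (n₀ := 0) rfl
  obtain ⟨φ, rfl⟩ := (Ext.mk₀_bijective _ _).2 y
  obtain ⟨ψ, rfl⟩ := h φ
  rw [← Ext.mk₀_comp_mk₀]
  rw [← Ext.comp_assoc hS.extClass (Ext.mk₀ S.f) (Ext.mk₀ ψ) (add_zero 1) (add_zero 0) (by simp)]
  simp

lemma shortExact_map (F : ℬ ⥤ 𝒜) [F.Additive] [PreservesFiniteColimits F]
    [PreservesFiniteLimits F] {S : ShortComplex ℬ} (hS : S.ShortExact) :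
    (S.map F).ShortExact := hS.map_of_exact F

lemma weak_of_joint [EnoughProjectives ℬ]
    [HasExt.{w₁} 𝒜] [HasExt.{w₂} ℬ] [HasExt.{w₃} 𝒞]
    (F : ℬ ⥤ 𝒜) (G : ℬ ⥤ 𝒞) [F.Additive] [G.Additive]
    [PreservesFiniteColimits F] [PreservesFiniteColimits G]
    [PreservesFiniteLimits F] [PreservesFiniteLimits G]
    (hz : JointZero F G)
    (full : ∀ (X Y : ℬ) (a : F.obj X ⟶ F.obj Y) (c : G.obj X ⟶ G.obj Y),
      ∃ h : X ⟶ Y, F.map h = a ∧ G.map h = c)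
    (es : ∀ (A : 𝒜) (C : 𝒞), ∃ B : ℬ, Nonempty (A ≅ F.obj B) ∧ Nonempty (C ≅ G.obj B))
    (pF : ∀ P : ℬ, Projective P → Projective (F.obj P))
    (pG : ∀ P : ℬ, Projective P → Projective (G.obj P))
    (𝒵' : Set 𝒜) (𝒵'' : Set 𝒞)
    (good' : IsGoodSubcat 𝒵') (good'' : IsGoodSubcat 𝒵'')
    (h' : WeakSupportTauTilting 𝒵') (h'' : WeakSupportTauTilting 𝒵'') :
    WeakSupportTauTilting {Z : ℬ | F.obj Z ∈ 𝒵' ∧ G.obj Z ∈ 𝒵''} := by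
  constructor
  · rintro M ⟨hM', hM''⟩ L ⟨N, ⟨hN', hN''⟩, q, hq⟩
    have e' : Subsingleton (Ext (F.obj M) (F.obj L) 1) :=
      h'.1 _ hM' _ ⟨_, hN', F.map q, inferInstance⟩
    have e'' : Subsingleton (Ext (G.obj M) (G.obj L) 1) :=
      h''.1 _ hM'' _ ⟨_, hN'', G.map q, inferInstance⟩
    let S : ShortComplex ℬ := ShortComplex.mk _ _ (kernel.condition (Projective.π M))
    have hS : S.ShortExact :=
      { exact := ShortComplex.exact_of_f_is_kernel _ (kernelIsKernel (Projective.π M))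
        mono_f := inferInstanceAs (Mono (kernel.ι _))
        epi_g := inferInstanceAs (Epi (Projective.π M)) }
    have : Projective S.X₂ := inferInstanceAs (Projective (Projective.over M))
    refine subsingleton_ext_of_exists hS L fun φ => ?_
    obtain ⟨a, ha⟩ := exists_ext_of_subsingleton (shortExact_map F hS) (F.obj L) e' (F.map φ)
    obtain ⟨c, hc⟩ := exists_ext_of_subsingleton (shortExact_map G hS) (G.obj L) e'' (G.map φ)
    obtain ⟨ψ, h₁, h₂⟩ := full _ _ a c
    refine ⟨ψ, hz.ext ?_ ?_⟩
    · rw [F.map_comp, h₁]; exact ha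
    · rw [G.map_comp, h₂]; exact hc
  · intro P hP
    obtain ⟨A₀, A₁, f', g', hA₀, hA₁, hg', ⟨w', ex'⟩, -, ap'⟩ := h'.2 _ (pF P hP)
    obtain ⟨C₀, C₁, f'', g'', hC₀, hC₁, hg'', ⟨w'', ex''⟩, -, ap''⟩ := h''.2 _ (pG P hP)
    obtain ⟨M₀, ⟨a₀⟩, ⟨c₀⟩⟩ := es A₀ C₀
    obtain ⟨M₁, ⟨a₁⟩, ⟨c₁⟩⟩ := es A₁ C₁
    obtain ⟨f, hf₁, hf₂⟩ := full P M₀ (f' ≫ a₀.hom) (f'' ≫ c₀.hom)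
    obtain ⟨g, hg₁, hg₂⟩ := full M₀ M₁ (a₀.inv ≫ g' ≫ a₁.hom) (c₀.inv ≫ g'' ≫ c₁.hom)
    have w : f ≫ g = 0 := by
      refine hz.eq_zero _ ?_ ?_
      · simp [hf₁, hg₁, reassoc_of% w']
      · simp [hf₂, hg₂, reassoc_of% w'']
    have hM₀ : F.obj M₀ ∈ 𝒵' ∧ G.obj M₀ ∈ 𝒵'' := ⟨good'.1 a₀ hA₀, good''.1 c₀ hC₀⟩
    refine ⟨M₀, M₁, f, g, hM₀, ⟨good'.1 a₁ hA₁, good''.1 c₁ hC₁⟩, ?_, ⟨w, ?_⟩, hM₀, ?_⟩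
    · refine hz.epi g ?_ ?_
      · rw [hg₁]; infer_instance
      · rw [hg₂]; infer_instance
    · refine hz.exact _ ?_ ?_
      · refine ShortComplex.exact_of_iso (S₁ := ShortComplex.mk f' g' w')
          (ShortComplex.isoMk (Iso.refl (F.obj P)) a₀ a₁ ?_ ?_) ex'
        · change 𝟙 (F.obj P) ≫ F.map f = f' ≫ a₀.hom
          simp [hf₁]
        · change a₀.hom ≫ F.map g = g' ≫ a₁.hom
          simp [hg₁]
      · refine ShortComplex.exact_of_iso (S₁ := ShortComplex.mk f'' g'' w'')
          (ShortComplex.isoMk (Iso.refl (G.obj P)) c₀ c₁ ?_ ?_) ex''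
        · change 𝟙 (G.obj P) ≫ G.map f = f'' ≫ c₀.hom
          simp [hf₂]
        · change c₀.hom ≫ G.map g = g'' ≫ c₁.hom
          simp [hg₂]
    · rintro M' ⟨hM'₁, hM'₂⟩ k
      obtain ⟨a, ha⟩ := ap' _ hM'₁ (F.map k)
      obtain ⟨c, hc⟩ := ap'' _ hM'₂ (G.map k)
      obtain ⟨h, h₁, h₂⟩ := full M₀ M' (a₀.inv ≫ a) (c₀.inv ≫ c)
      refine ⟨h, hz.ext ?_ ?_⟩
      · simp [h₁, hf₁, ha]
      · simp [h₂, hf₂, hc]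

end Helpers

/-- If `𝒵'` and `𝒵''` are weak support τ-tilting subcategories of `𝒜` and `𝒞`, and
`i^*`, `i^!` are exact, then `𝒵 = {Z ∈ ℬ | i^!(Z) ∈ 𝒵', j^*(Z) ∈ 𝒵''}` is a weak support
τ-tilting subcategory of `ℬ`. -/
theorem stmt_3
    {𝒜 : Type u₁} {ℬ : Type u₂} {𝒞 : Type u₃}
    [Category.{v₁} 𝒜] [Category.{v₂} ℬ] [Category.{v₃} 𝒞]
    [Abelian 𝒜] [Abelian ℬ] [Abelian 𝒞]
    [EnoughProjectives 𝒜] [EnoughInjectives 𝒜]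
    [EnoughProjectives ℬ] [EnoughInjectives ℬ]
    [EnoughProjectives 𝒞] [EnoughInjectives 𝒞]
    [HasExt.{w₁} 𝒜] [HasExt.{w₂} ℬ] [HasExt.{w₃} 𝒞]
    (R : Recollement 𝒜 ℬ 𝒞)
    (𝒵' : Set 𝒜) (𝒵'' : Set 𝒞)
    (good' : IsGoodSubcat 𝒵') (good'' : IsGoodSubcat 𝒵'')
    (h' : WeakSupportTauTilting 𝒵') (h'' : WeakSupportTauTilting 𝒵'')
    [PreservesFiniteLimits R.iUS] [PreservesFiniteColimits R.iUS]
    [PreservesFiniteLimits R.iUE] [PreservesFiniteColimits R.iUE] :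
    WeakSupportTauTilting {Z : ℬ | R.iUE.obj Z ∈ 𝒵' ∧ R.jUS.obj Z ∈ 𝒵''} := by
  have := R.iStar_full
  have := R.iStar_faithful
  have := R.jLE_full
  have := R.jLE_faithful
  have := R.jLS_full
  have := R.jLS_faithful
  have : R.iStar.IsRightAdjoint := R.adj₁.isRightAdjoint
  have : R.iStar.IsLeftAdjoint := R.adj₂.isLeftAdjoint
  have : R.jUS.IsRightAdjoint := R.adj₃.isRightAdjoint
  have : R.jUS.IsLeftAdjoint := R.adj₄.isLeftAdjoint
  have : R.jLS.IsRightAdjoint := R.adj₄.isRightAdjoint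
  have : R.jLE.IsLeftAdjoint := R.adj₃.isLeftAdjoint
  have : PreservesFiniteLimits R.iStar :=
    ⟨fun J _ _ => inferInstance⟩
  have : PreservesFiniteColimits R.iStar :=
    ⟨fun J _ _ => inferInstance⟩
  have : PreservesFiniteLimits R.jUS :=
    ⟨fun J _ _ => inferInstance⟩
  have : PreservesFiniteColimits R.jUS :=
    ⟨fun J _ _ => inferInstance⟩
  have : PreservesFiniteLimits R.jLS :=
    ⟨fun J _ _ => inferInstance⟩
  have : R.iStar.Additive := Functor.additive_of_preserves_binary_products _
  have : R.iUS.Additive := Functor.additive_of_preserves_binary_products _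
  have : R.iUE.Additive := Functor.additive_of_preserves_binary_products _
  have : R.jUS.Additive := Functor.additive_of_preserves_binary_products _
  have : R.jLS.Additive := Functor.additive_of_preserves_binary_products _
  -- vanishing
  have zji (A : 𝒜) : IsZero (R.jUS.obj (R.iStar.obj A)) :=
    (R.essImage_iStar _).1 (R.iStar.obj_mem_essImage A)
  have zij (C : 𝒞) : IsZero (R.iUE.obj (R.jLS.obj C)) := by
    rw [IsZero.iff_id_eq_zero]
    apply (R.adj₂.homEquiv _ _).symm.injective
    apply (R.adj₄.homEquiv _ _).symm.injective
    exact (zji _).eq_of_src _ _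
  have zij' (C : 𝒞) : IsZero (R.iUS.obj (R.jLE.obj C)) := by
    rw [IsZero.iff_id_eq_zero]
    apply (R.adj₁.homEquiv _ _).injective
    apply (R.adj₃.homEquiv _ _).injective
    exact (zji _).eq_of_tgt _ _
  have hz : JointZero R.iUE R.jUS := by
    intro X h₁ h₂
    obtain ⟨A, ⟨e⟩⟩ := (R.essImage_iStar X).2 h₂
    have : IsZero A := (h₁.of_iso (R.iUE.mapIso e)).of_iso (asIso (R.adj₂.unit.app A))
    exact (R.iStar.map_isZero this).of_iso e.symm
  have hz' : JointZero R.iUS R.jUS := by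
    intro X h₁ h₂
    obtain ⟨A, ⟨e⟩⟩ := (R.essImage_iStar X).2 h₂
    have : IsZero A := (h₁.of_iso (R.iUS.mapIso e)).of_iso (asIso (R.adj₁.counit.app A)).symm
    exact (R.iStar.map_isZero this).of_iso e.symm
  -- the counit `ε : i_* i^! X ⟶ X` and the unit `η : X ⟶ i_* i^* X`
  have iso₁ (X : ℬ) : IsIso (R.iUE.map (R.adj₂.counit.app X)) := inferInstance
  have iso₂ (X : ℬ) : IsIso (R.iUS.map (R.adj₁.unit.app X)) := inferInstance
  have mono_ε (X : ℬ) : Mono (R.adj₂.counit.app X) :=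
    hz.mono _ inferInstance ⟨fun _ _ _ => (zji _).eq_of_tgt _ _⟩
  have epi_η (X : ℬ) : Epi (R.adj₁.unit.app X) :=
    hz'.epi _ inferInstance ⟨fun _ _ _ => (zji _).eq_of_src _ _⟩
  have iso_εη (X : ℬ) : IsIso (R.adj₂.counit.app X ≫ R.adj₁.unit.app X) := by
    have : Mono (R.adj₂.counit.app X ≫ R.adj₁.unit.app X) := by
      refine hz'.mono _ ?_ ⟨fun _ _ _ => (zji _).eq_of_tgt _ _⟩
      rw [Functor.map_comp]; infer_instance
    have : Epi (R.adj₂.counit.app X ≫ R.adj₁.unit.app X) := by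
      refine hz.epi _ ?_ ⟨fun _ _ _ => (zji _).eq_of_src _ _⟩
      rw [Functor.map_comp]; infer_instance
    exact isIso_of_mono_of_epi _
  have isoA (X : ℬ) : Nonempty (R.iUE.obj X ≅ R.iUS.obj X) :=
    ⟨R.iStar.preimageIso (asIso (R.adj₂.counit.app X ≫ R.adj₁.unit.app X))⟩
  have zij'' (C : 𝒞) : IsZero (R.iUE.obj (R.jLE.obj C)) :=
    (zij' C).of_iso (isoA _).some
  have iso_θ (X : ℬ) : IsIso (R.adj₃.counit.app X ≫ R.adj₄.unit.app X) := by
    refine hz.isIso _ ?_ ?_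
    · exact ⟨0, (zij'' _).eq_of_src _ _, (zij _).eq_of_src _ _⟩
    · rw [Functor.map_comp]; infer_instance
  have full₁ (X Y : ℬ) (a : R.iUE.obj X ⟶ R.iUE.obj Y) :
      ∃ h : X ⟶ Y, R.iUE.map h = a ∧ R.jUS.map h = 0 := by
    let p : X ⟶ R.iStar.obj (R.iUE.obj X) :=
      R.adj₁.unit.app X ≫ inv (R.adj₂.counit.app X ≫ R.adj₁.unit.app X)
    have hp : R.adj₂.counit.app X ≫ p = 𝟙 _ := by
      rw [← Category.assoc, IsIso.hom_inv_id]
    refine ⟨p ≫ R.iStar.map a ≫ R.adj₂.counit.app Y, ?_, ?_⟩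
    · rw [← cancel_epi (R.iUE.map (R.adj₂.counit.app X)), ← Functor.map_comp, reassoc_of% hp,
        ← cancel_epi (R.adj₂.unit.app (R.iUE.obj X)), Functor.map_comp]
      have := R.adj₂.unit.naturality a
      simp only [Functor.id_map, Functor.comp_map, Functor.id_obj, Functor.comp_obj] at this
      rw [← reassoc_of% this, R.adj₂.right_triangle_components,
        R.adj₂.right_triangle_components_assoc, Category.comp_id]
    · rw [Functor.map_comp, (zji _).eq_of_tgt (R.jUS.map p) 0, zero_comp]
  have full₂ (X Y : ℬ) (c : R.jUS.obj X ⟶ R.jUS.obj Y) :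
      ∃ h : X ⟶ Y, R.iUE.map h = 0 ∧ R.jUS.map h = c := by
    let s : R.jLS.obj (R.jUS.obj Y) ⟶ Y :=
      inv (R.adj₃.counit.app Y ≫ R.adj₄.unit.app Y) ≫ R.adj₃.counit.app Y
    have hs : s ≫ R.adj₄.unit.app Y = 𝟙 _ := by
      rw [Category.assoc, IsIso.inv_hom_id]
    refine ⟨R.adj₄.unit.app X ≫ R.jLS.map c ≫ s, ?_, ?_⟩
    · rw [Functor.map_comp, (zij _).eq_of_tgt (R.iUE.map (R.adj₄.unit.app X)) 0, zero_comp]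
    · rw [← cancel_mono (R.jUS.map (R.adj₄.unit.app Y)), ← Functor.map_comp, Category.assoc,
        Category.assoc, hs, Category.comp_id, ← cancel_mono (R.adj₄.counit.app (R.jUS.obj Y)), Functor.map_comp]
      simp
  have full (X Y : ℬ) (a : R.iUE.obj X ⟶ R.iUE.obj Y) (c : R.jUS.obj X ⟶ R.jUS.obj Y) :
      ∃ h : X ⟶ Y, R.iUE.map h = a ∧ R.jUS.map h = c := by
    obtain ⟨h₁, ha, ha'⟩ := full₁ X Y a
    obtain ⟨h₂, hc, hc'⟩ := full₂ X Y c
    exact ⟨h₁ + h₂, by simp [Functor.map_add, ha, hc], by simp [Functor.map_add, ha', hc']⟩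
  have es (A : 𝒜) (C : 𝒞) :
      ∃ B : ℬ, Nonempty (A ≅ R.iUE.obj B) ∧ Nonempty (C ≅ R.jUS.obj B) := by
    refine ⟨R.iStar.obj A ⊞ R.jLS.obj C, ⟨asIso (R.adj₂.unit.app A) ≪≫
      ⟨R.iUE.map biprod.inl, R.iUE.map biprod.fst, ?_, ?_⟩⟩,
      ⟨(asIso (R.adj₄.counit.app C)).symm ≪≫
      ⟨R.jUS.map biprod.inr, R.jUS.map biprod.snd, ?_, ?_⟩⟩⟩
    · rw [← Functor.map_comp, biprod.inl_fst]; simp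
    · have := congrArg R.iUE.map (biprod.total (X := R.iStar.obj A) (Y := R.jLS.obj C))
      rw [Functor.map_add, Functor.map_comp, Functor.map_comp,
        (zij C).eq_of_tgt (R.iUE.map biprod.snd) 0, zero_comp, add_zero] at this
      rw [this, CategoryTheory.Functor.map_id]
    · rw [← Functor.map_comp, biprod.inr_snd]; simp
    · have := congrArg R.jUS.map (biprod.total (X := R.iStar.obj A) (Y := R.jLS.obj C))
      rw [Functor.map_add, Functor.map_comp, Functor.map_comp,
        (zji A).eq_of_tgt (R.jUS.map biprod.fst) 0, zero_comp, zero_add] at this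
      rw [this, CategoryTheory.Functor.map_id]
  have : R.jLS.PreservesEpimorphisms := ⟨fun {X Y} f hf => by
    refine hz.epi _ ⟨fun _ _ _ => (zij _).eq_of_src _ _⟩ ?_
    have := R.adj₄.counit.naturality f
    have e : R.jUS.map (R.jLS.map f) =
        R.adj₄.counit.app X ≫ f ≫ inv (R.adj₄.counit.app Y) := by
      rw [← Category.assoc, IsIso.eq_comp_inv]; exact this
    rw [e]; infer_instance⟩
  exact weak_of_joint R.iUE R.jUS hz full es
    (fun P hP => Projective.of_iso (isoA P).some.symm (R.adj₁.map_projective P hP))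
    (fun P hP => R.adj₄.map_projective P hP) 𝒵' 𝒵'' good' good'' h' h''
end

section
/- Let (𝒜, ℬ, 𝒞) be a recollement of abelian categories and let 𝒴 be a weak support τ-tilting subcategory of ℬ. If i^* and i^! are exact, i_* i^*(𝒴) ⊆ 𝒴, and j_* j^*(𝒴) ⊆ 𝒴, then i^*(𝒴) and j^*(𝒴) are weak support τ-tilting subcategories of 𝒜 and 𝒞, respectively. -/
open CategoryTheory Limits Abelian

universe w₁ w₂ w₃ v₁ v₂ v₃ u₁ u₂ u₃

variable {𝒟 : Type u₁} [Category.{v₁} 𝒟] [Abelian 𝒟]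

/-- `Ext¹` vanishing transported along an adjunction `F ⊣ G` with `G` exact. -/
lemma ext_part {X : Type u₁} {Z : Type u₂} [Category.{v₁} X] [Category.{v₂} Z]
    [Abelian X] [Abelian Z] [EnoughInjectives Z] [HasExt.{w₁} X] [HasExt.{w₂} Z]
    {F : X ⥤ Z} {G : Z ⥤ X} (adj : F ⊣ G) [G.PreservesEpimorphisms]
    (S : Set X) (hS : ∀ M ∈ S, ∀ L ∈ Fac S, Subsingleton (Ext M L 1))
    (h : ∀ Y ∈ S, G.obj (F.obj Y) ∈ S) :
    ∀ M ∈ imgCl F S, ∀ L ∈ Fac (imgCl F S), Subsingleton (Ext M L 1) := by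
  rintro M ⟨Y, hY, ⟨eM⟩⟩ L ⟨N, ⟨Y', hY', ⟨eN⟩⟩, p, hp⟩
  have : G.IsRightAdjoint := adj.isRightAdjoint
  have hlim : PreservesFiniteLimits G :=
    ⟨fun _ _ _ => adj.rightAdjoint_preservesLimits.preservesLimitsOfShape⟩
  have hadd : G.Additive := Functor.additive_of_preserves_binary_products G
  have hfac : G.obj L ∈ Fac S := ⟨_, h Y' hY', G.map (eN.hom ≫ p), inferInstance⟩
  have hsub := hS Y hY _ hfac
  let T : ShortComplex Z := ShortComplex.mk (Injective.ι L) (cokernel.π (Injective.ι L))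
    (cokernel.condition _)
  have hT : T.ShortExact := { exact := ShortComplex.exact_cokernel _ }
  have : Mono T.f := hT.mono_f
  have : Epi T.g := hT.epi_g
  have hGT : (T.map G).ShortExact :=
    { exact := hT.exact.map_of_mono_of_preservesKernel G inferInstance inferInstance
      mono_f := inferInstanceAs (Mono (G.map T.f))
      epi_g := inferInstanceAs (Epi (G.map T.g)) }
  refine subsingleton_of_forall_eq 0 fun e => ?_
  obtain ⟨x₃, rfl⟩ := Ext.covariant_sequence_exact₁ M hT e
    (Ext.eq_zero_of_injective (I := Injective.under L) _) (zero_add 1)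
  obtain ⟨x, rfl⟩ := (Ext.mk₀_bijective _ _).2 x₃
  obtain ⟨y, hy⟩ := Ext.covariant_sequence_exact₃ Y hGT
    (Ext.mk₀ (adj.homEquiv _ _ (eM.hom ≫ x))) (zero_add 1) (hsub.elim _ _)
  obtain ⟨y, rfl⟩ := (Ext.mk₀_bijective _ _).2 y
  rw [Ext.mk₀_comp_mk₀] at hy
  have hy' : y ≫ G.map T.g = adj.homEquiv _ _ (eM.hom ≫ x) := (Ext.mk₀_bijective _ _).1 hy
  have key : ∀ z : Y ⟶ G.obj T.X₂, z ≫ G.map T.g = adj.homEquiv _ _ (eM.hom ≫ x) →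
      x = (eM.inv ≫ (adj.homEquiv _ _).symm z) ≫ T.g := by
    intro z hz
    rw [Category.assoc, ← Adjunction.homEquiv_naturality_right_symm, hz]
    simp
  have hx := key y hy'
  rw [hx, ← Ext.mk₀_comp_mk₀, Ext.comp_assoc_of_second_deg_zero,
    ShortComplex.ShortExact.comp_extClass, Ext.comp_zero]

lemma approx_part {X : Type u₁} {Z : Type u₂} [Category.{v₁} X] [Category.{v₂} Z]
    [Abelian X] [Abelian Z] {F : X ⥤ Z} [PreservesFiniteColimits F]
    (S : Set X) {P : Z} {Q : X} (e : P ≅ F.obj Q)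
    (hQ : ∃ (M₀ M₁ : X) (f : Q ⟶ M₀) (g : M₀ ⟶ M₁),
      M₀ ∈ S ∧ M₁ ∈ S ∧ Epi g ∧ ExactAt f g ∧ IsLeftApprox S f)
    (hext : ∀ Y ∈ S, ∀ g : F.obj Q ⟶ F.obj Y,
      ∃ Y' ∈ S, ∃ (t : Q ⟶ Y') (s : F.obj Y' ⟶ F.obj Y), g = F.map t ≫ s) :
    ∃ (M₀ M₁ : Z) (f : P ⟶ M₀) (g : M₀ ⟶ M₁),
      M₀ ∈ imgCl F S ∧ M₁ ∈ imgCl F S ∧ Epi g ∧ ExactAt f g ∧ IsLeftApprox (imgCl F S) f := by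
  obtain ⟨M₀, M₁, f, g, hM₀, hM₁, hg, ⟨w, hex⟩, -, happ⟩ := hQ
  have hbi : PreservesBinaryBiproducts F :=
    preservesBinaryBiproducts_of_preservesBinaryCoproducts F
  have hadd : F.Additive := Functor.additive_of_preservesBinaryBiproducts F
  have m₀ : F.obj M₀ ∈ imgCl F S := ⟨M₀, hM₀, ⟨Iso.refl _⟩⟩
  have w' : (e.hom ≫ F.map f) ≫ F.map g = 0 := by
    rw [Category.assoc, ← F.map_comp, w, F.map_zero, comp_zero]
  refine ⟨F.obj M₀, F.obj M₁, e.hom ≫ F.map f, F.map g, m₀, ⟨M₁, hM₁, ⟨Iso.refl _⟩⟩,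
    inferInstance, ⟨w', ?_⟩, m₀, ?_⟩
  · have h1 := hex.map_of_epi_of_preservesCokernel F hg inferInstance
    refine (ShortComplex.exact_iff_of_iso ?_).1 h1
    exact ShortComplex.isoMk e.symm (Iso.refl (F.obj M₀)) (Iso.refl (F.obj M₁))
      (by change e.inv ≫ e.hom ≫ F.map f = F.map f ≫ 𝟙 (F.obj M₀); simp)
      (by change 𝟙 (F.obj M₀) ≫ F.map g = F.map g ≫ 𝟙 (F.obj M₁); simp)
  · rintro M' ⟨Y, hY, ⟨eY⟩⟩ h
    obtain ⟨Y', hY', t, s, hts⟩ := hext Y hY (e.inv ≫ h ≫ eY.inv)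
    obtain ⟨k, rfl⟩ := happ Y' hY' t
    refine ⟨F.map k ≫ s ≫ eY.hom, ?_⟩
    rw [F.map_comp, Category.assoc] at hts
    have : e.hom ≫ (e.inv ≫ h ≫ eY.inv) ≫ eY.hom = h := by simp
    rw [← this, hts]
    simp

/-- `i^!` exact implies that `j_*` preserves epimorphisms. -/
lemma jLS_epi {𝒜 : Type u₁} {ℬ : Type u₂} {𝒞 : Type u₃}
    [Category.{v₁} 𝒜] [Category.{v₂} ℬ] [Category.{v₃} 𝒞]
    [Abelian 𝒜] [Abelian ℬ] [Abelian 𝒞] (R : Recollement 𝒜 ℬ 𝒞)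
    [PreservesFiniteColimits R.iUE] : R.jLS.PreservesEpimorphisms := by
  have := R.iStar_full
  have := R.iStar_faithful
  have := R.jLS_full
  have := R.jLS_faithful
  have : R.jUS.IsLeftAdjoint := R.adj₄.isLeftAdjoint
  have hz1 : ∀ A : 𝒜, IsZero (R.jUS.obj (R.iStar.obj A)) := fun A =>
    (R.essImage_iStar _).1 (R.iStar.obj_mem_essImage A)
  have hz2 : ∀ Y : 𝒞, IsZero (R.iUE.obj (R.jLS.obj Y)) := fun Y => by
    rw [IsZero.iff_id_eq_zero]
    apply (R.adj₂.homEquiv _ _).symm.injective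
    apply (R.adj₄.homEquiv _ _).symm.injective
    exact (hz1 _).eq_of_src _ _
  refine ⟨fun {U V} f hf => ?_⟩
  have hepi : Epi (R.jUS.map (R.jLS.map f)) := by
    have : R.jUS.map (R.jLS.map f) = R.adj₄.counit.app U ≫ f ≫ inv (R.adj₄.counit.app V) := by
      have := R.adj₄.counit.naturality f
      simp only [Functor.comp_map, Functor.id_map] at this
      rw [← Category.assoc]
      exact (IsIso.eq_comp_inv _).2 this
    rw [this]
    exact epi_comp' inferInstance (epi_comp' hf inferInstance)
  have hK : IsZero (R.jUS.obj (cokernel (R.jLS.map f))) := by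
    have h0 : R.jUS.map (cokernel.π (R.jLS.map f)) = 0 := by
      have hj : R.jUS.PreservesZeroMorphisms := inferInstance
      rw [← cancel_epi (R.jUS.map (R.jLS.map f)), ← R.jUS.map_comp, cokernel.condition,
        R.jUS.map_zero, comp_zero]
    exact IsZero.of_epi_eq_zero _ h0
  obtain ⟨A, ⟨eA⟩⟩ := (R.essImage_iStar _).2 hK
  have hK2 : IsZero (R.iUE.obj (cokernel (R.jLS.map f))) :=
    IsZero.of_epi (R.iUE.map (cokernel.π (R.jLS.map f))) (hz2 V)
  have hA : IsZero A :=
    hK2.of_iso ((asIso (R.adj₂.unit.app A)) ≪≫ R.iUE.mapIso eA)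
  have : R.iStar.IsLeftAdjoint := R.adj₂.isLeftAdjoint
  have hK3 : IsZero (cokernel (R.jLS.map f)) := (R.iStar.map_isZero hA).of_iso eA.symm
  exact Preadditive.epi_of_isZero_cokernel _ hK3

/-- If `𝒴` is a weak support τ-tilting subcategory of `ℬ`, `i^*` and `i^!` are exact,
`i_* i^*(𝒴) ⊆ 𝒴` and `j_* j^*(𝒴) ⊆ 𝒴`, then `i^*(𝒴)` and `j^*(𝒴)` are weak support
τ-tilting subcategories of `𝒜` and `𝒞` respectively. -/
theorem stmt_4
    {𝒜 : Type u₁} {ℬ : Type u₂} {𝒞 : Type u₃}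
    [Category.{v₁} 𝒜] [Category.{v₂} ℬ] [Category.{v₃} 𝒞]
    [Abelian 𝒜] [Abelian ℬ] [Abelian 𝒞]
    [EnoughProjectives 𝒜] [EnoughInjectives 𝒜]
    [EnoughProjectives ℬ] [EnoughInjectives ℬ]
    [EnoughProjectives 𝒞] [EnoughInjectives 𝒞]
    [HasExt.{w₁} 𝒜] [HasExt.{w₂} ℬ] [HasExt.{w₃} 𝒞]
    (R : Recollement 𝒜 ℬ 𝒞)
    (𝒴 : Set ℬ) (good : IsGoodSubcat 𝒴)
    (hwst : WeakSupportTauTilting 𝒴)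
    [PreservesFiniteLimits R.iUS] [PreservesFiniteColimits R.iUS]
    [PreservesFiniteLimits R.iUE] [PreservesFiniteColimits R.iUE]
    (h₁ : ∀ Y ∈ 𝒴, R.iStar.obj (R.iUS.obj Y) ∈ 𝒴)
    (h₂ : ∀ Y ∈ 𝒴, R.jLS.obj (R.jUS.obj Y) ∈ 𝒴) :
    WeakSupportTauTilting (imgCl R.iUS 𝒴) ∧ WeakSupportTauTilting (imgCl R.jUS 𝒴) := by
  have := R.iStar_full
  have := R.iStar_faithful
  have := R.jLE_full
  have := R.jLE_faithful
  have := jLS_epi R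
  have : R.jUS.IsLeftAdjoint := R.adj₄.isLeftAdjoint
  have : R.iStar.IsLeftAdjoint := R.adj₂.isLeftAdjoint
  have hj : PreservesFiniteColimits R.jUS :=
    ⟨fun _ _ _ => R.adj₄.leftAdjoint_preservesColimits.preservesColimitsOfShape⟩
  refine ⟨⟨ext_part R.adj₁ 𝒴 hwst.1 h₁, fun P hP => ?_⟩,
    ⟨ext_part R.adj₄ 𝒴 hwst.1 h₂, fun P hP => ?_⟩⟩
  · refine approx_part 𝒴 (asIso (R.adj₁.counit.app P)).symm
      (hwst.2 _ (R.adj₂.map_projective P hP)) fun Y hY g =>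
      ⟨_, h₁ Y hY, R.adj₁.homEquiv _ _ g, R.adj₁.counit.app _, ?_⟩
    rw [← Adjunction.homEquiv_counit, Equiv.symm_apply_apply]
  · refine approx_part 𝒴 (asIso (R.adj₃.unit.app P))
      (hwst.2 _ (R.adj₃.map_projective P hP)) fun Y hY g =>
      ⟨Y, hY, (R.adj₃.homEquiv _ _).symm (R.adj₃.unit.app P ≫ g), 𝟙 _, ?_⟩
    rw [Category.comp_id, ← cancel_epi (R.adj₃.unit.app P)]
    exact (Equiv.apply_symm_apply _ _).symm.trans (Adjunction.homEquiv_unit _ _ _ _)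
end

section
/- Let (𝒜, ℬ, 𝒞) be a recollement of abelian categories and let 𝒴 be a contravariantly finite subcategory of ℬ. If i^* and i^! are exact, i_* i^!(𝒴) ⊆ 𝒴, i_* i^*(𝒴) ⊆ 𝒴, and j_! j^*(𝒴) ⊆ 𝒴, then i^*(𝒴) and j^*(𝒴) are contravariantly finite subcategories of 𝒜 and 𝒞, respectively. -/
open CategoryTheory Limits Abelian

universe w₁ w₂ w₃ v₁ v₂ v₃ u₁ u₂ u₃

variable {𝒟 : Type u₁} [Category.{v₁} 𝒟] [Abelian 𝒟]

/-- If `𝒴` is a contravariantly finite subcategory of `ℬ`, `i^*` and `i^!` are exact,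
`i_* i^!(𝒴) ⊆ 𝒴`, `i_* i^*(𝒴) ⊆ 𝒴` and `j_! j^*(𝒴) ⊆ 𝒴`, then `i^*(𝒴)` and `j^*(𝒴)` are
contravariantly finite subcategories of `𝒜` and `𝒞` respectively. -/
theorem stmt_7
    {𝒜 : Type u₁} {ℬ : Type u₂} {𝒞 : Type u₃}
    [Category.{v₁} 𝒜] [Category.{v₂} ℬ] [Category.{v₃} 𝒞]
    [Abelian 𝒜] [Abelian ℬ] [Abelian 𝒞]
    [EnoughProjectives 𝒜] [EnoughInjectives 𝒜]
    [EnoughProjectives ℬ] [EnoughInjectives ℬ]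
    [EnoughProjectives 𝒞] [EnoughInjectives 𝒞]
    (R : Recollement 𝒜 ℬ 𝒞)
    (𝒴 : Set ℬ) (good : IsGoodSubcat 𝒴)
    (hcf : ContravariantlyFinite 𝒴)
    [PreservesFiniteLimits R.iUS] [PreservesFiniteColimits R.iUS]
    [PreservesFiniteLimits R.iUE] [PreservesFiniteColimits R.iUE]
    (h₁ : ∀ Y ∈ 𝒴, R.iStar.obj (R.iUE.obj Y) ∈ 𝒴)
    (h₂ : ∀ Y ∈ 𝒴, R.iStar.obj (R.iUS.obj Y) ∈ 𝒴)
    (h₃ : ∀ Y ∈ 𝒴, R.jLE.obj (R.jUS.obj Y) ∈ 𝒴) :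
    ContravariantlyFinite (imgCl R.iUS 𝒴) ∧ ContravariantlyFinite (imgCl R.jUS 𝒴) := by
  have := R.iStar_full
  have := R.iStar_faithful
  have := R.jLE_full
  have := R.jLE_faithful
  constructor
  · intro A
    obtain ⟨Y, f, hY, hf⟩ := hcf (R.iStar.obj A)
    refine ⟨R.iUS.obj Y, R.iUS.map f ≫ R.adj₁.counit.app A, ⟨Y, hY, ⟨Iso.refl _⟩⟩, ?_⟩
    rintro M' ⟨Y', hY', ⟨e⟩⟩ g
    obtain ⟨h, hh⟩ := hf (R.iStar.obj M') (good.1 (R.iStar.mapIso e) (h₂ Y' hY'))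
      (R.iStar.map g)
    refine ⟨inv (R.adj₁.counit.app M') ≫ R.iUS.map h, ?_⟩
    rw [Category.assoc, ← Category.assoc (R.iUS.map h), ← R.iUS.map_comp, hh,
      IsIso.inv_comp_eq]
    exact R.adj₁.counit.naturality g
  · intro C
    obtain ⟨Y, f, hY, hf⟩ := hcf (R.jLS.obj C)
    refine ⟨R.jUS.obj Y, R.jUS.map f ≫ R.adj₄.counit.app C, ⟨Y, hY, ⟨Iso.refl _⟩⟩, ?_⟩
    rintro M' ⟨Y', hY', ⟨e⟩⟩ g
    obtain ⟨h, hh⟩ := hf (R.jLE.obj M') (good.1 (R.jLE.mapIso e) (h₃ Y' hY'))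
      (R.adj₄.homEquiv _ _ (inv (R.adj₃.unit.app M') ≫ g))
    refine ⟨R.adj₃.unit.app M' ≫ R.jUS.map h, ?_⟩
    rw [Category.assoc, ← Category.assoc (R.jUS.map h), ← R.jUS.map_comp, hh,
      ← R.adj₄.homEquiv_counit, Equiv.symm_apply_apply]
    exact IsIso.hom_inv_id_assoc _ _
end

section
/- Let (𝒜, ℬ, 𝒞) be a recollement of abelian categories and let 𝒴 be a support τ-tilting subcategory of ℬ. If i^* and i^! are exact, i_* i^!(𝒴) ⊆ 𝒴, i_* i^*(𝒴) ⊆ 𝒴, j_! j^*(𝒴) ⊆ 𝒴, and j_* j^*(𝒴) ⊆ 𝒴, then i^*(𝒴) and j^*(𝒴) are support τ-tilting subcategories of 𝒜 and 𝒞, respectively. -/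
open CategoryTheory Limits Abelian

universe w₁ w₂ w₃ v₁ v₂ v₃ u₁ u₂ u₃

variable {𝒟 : Type u₁} [Category.{v₁} 𝒟] [Abelian 𝒟]

/-- If every short exact sequence `0 ⟶ L ⟶ E ⟶ M ⟶ 0` has a section, then `Ext¹(M, L) = 0`. -/
lemma subsingleton_ext_one_of_splits {𝒟₁ : Type u₁} [Category.{v₁} 𝒟₁] [Abelian 𝒟₁]
    [EnoughProjectives 𝒟₁] [HasExt.{w₁} 𝒟₁] (M L : 𝒟₁)
    (H : ∀ (E : 𝒟₁) (a : L ⟶ E) (b : E ⟶ M) (w : a ≫ b = 0),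
      (ShortComplex.mk a b w).ShortExact → ∃ s : M ⟶ E, s ≫ b = 𝟙 M) :
    Subsingleton (Ext M L 1) := by
  refine subsingleton_of_forall_eq 0 fun x => ?_
  let p := Projective.π M
  let S : ShortComplex 𝒟₁ := ShortComplex.mk (kernel.ι p) p (kernel.condition p)
  have hS : S.ShortExact :=
    { exact := ShortComplex.exact_of_f_is_kernel _ (kernelIsKernel p)
      mono_f := inferInstanceAs (Mono (kernel.ι p))
      epi_g := inferInstanceAs (Epi (Projective.π M)) }
  have : Projective S.X₂ := inferInstanceAs (Projective (Projective.over M))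
  obtain ⟨y, hy⟩ := Ext.contravariant_sequence_exact₃ hS L x
    (Ext.eq_zero_of_projective _) (n₀ := 0) rfl
  obtain ⟨f, rfl⟩ := Ext.addEquiv₀.symm.surjective y
  let f' : kernel p ⟶ L := f
  let E := pushout (kernel.ι p) f'
  let q : E ⟶ M := pushout.desc p 0 (by simp)
  have hw : pushout.inr (kernel.ι p) f' ≫ q = 0 := pushout.inr_desc _ _ _
  have hq : pushout.inl (kernel.ι p) f' ≫ q = p := pushout.inl_desc _ _ _
  have : Epi p := inferInstanceAs (Epi (Projective.π M))
  have : Epi q := by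
    have : Epi (pushout.inl (kernel.ι p) f' ≫ q) := by rw [hq]; infer_instance
    exact epi_of_epi (pushout.inl (kernel.ι p) f') q
  have hT : (ShortComplex.mk _ q hw).ShortExact :=
    { exact := by
        rw [ShortComplex.exact_iff_exact_up_to_refinements]
        intro A x₂ hx₂
        obtain ⟨A', π, hπ, u, v, huv⟩ :=
          (IsPushout.of_hasPushout (kernel.ι p) f').hom_eq_add_up_to_refinements x₂
        have hu : u ≫ p = 0 := by
          have h := congrArg (· ≫ q) huv
          dsimp at h hx₂
          rw [Category.assoc, hx₂, Preadditive.add_comp, Category.assoc, Category.assoc, hq, hw]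
            at h
          simpa using h.symm
        refine ⟨A', π, hπ, kernel.lift p u hu ≫ f' + v, ?_⟩
        rw [huv, Preadditive.add_comp]
        congr 1
        rw [Category.assoc, ← pushout.condition, kernel.lift_ι_assoc]
      mono_f := inferInstanceAs (Mono (pushout.inr (kernel.ι p) f'))
      epi_g := inferInstanceAs (Epi q) }
  obtain ⟨s, hs⟩ := H E _ q hw hT
  let σ := ShortComplex.Splitting.ofExactOfSection _ hT.exact s hs hT.mono_f
  have hr : pushout.inr (kernel.ι p) f' ≫ σ.r = 𝟙 L := σ.f_r
  have hf : S.f ≫ (pushout.inl (kernel.ι p) f' ≫ σ.r) = f := by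
    change kernel.ι p ≫ (pushout.inl (kernel.ι p) f' ≫ σ.r) = f'
    rw [pushout.condition_assoc, hr, Category.comp_id]
  rw [← hy, ← hf]
  change hS.extClass.comp (Ext.mk₀ _) _ = 0
  rw [← Ext.mk₀_comp_mk₀, hS.extClass_comp_assoc]

/-- An epimorphism onto `M` with kernel `N`, `Ext¹(M, N) = 0`, has a section. -/
lemma exists_section_of_ext {𝒟₁ : Type u₁} [Category.{v₁} 𝒟₁] [Abelian 𝒟₁]
    [HasExt.{w₁} 𝒟₁] {E M : 𝒟₁} (b : E ⟶ M) [Epi b]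
    (h : Subsingleton (Ext M (kernel b) 1)) : ∃ s : M ⟶ E, s ≫ b = 𝟙 M := by
  let S : ShortComplex 𝒟₁ := ShortComplex.mk (kernel.ι b) b (kernel.condition b)
  have hS : S.ShortExact :=
    { exact := ShortComplex.exact_of_f_is_kernel _ (kernelIsKernel b)
      mono_f := inferInstanceAs (Mono (kernel.ι b))
      epi_g := inferInstanceAs (Epi b) }
  obtain ⟨y, hy⟩ := Ext.covariant_sequence_exact₃ M hS (Ext.mk₀ (𝟙 M)) (n₁ := 1) rfl
    (h.elim _ _)
  obtain ⟨s, rfl⟩ := Ext.addEquiv₀.symm.surjective y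
  refine ⟨s, ?_⟩
  change (Ext.mk₀ s).comp (Ext.mk₀ b) _ = _ at hy
  rw [Ext.mk₀_comp_mk₀] at hy
  exact Ext.addEquiv₀.symm.injective hy

/-- The common argument for both halves of the theorem. -/
lemma supportTauTilting_imgCl {ℬ : Type u₂} {𝒟₁ : Type u₁}
    [Category.{v₂} ℬ] [Category.{v₁} 𝒟₁] [Abelian ℬ] [Abelian 𝒟₁]
    [EnoughProjectives 𝒟₁] [HasExt.{w₂} ℬ] [HasExt.{w₁} 𝒟₁]
    (F : 𝒟₁ ⥤ ℬ) (G : ℬ ⥤ 𝒟₁) (e : F ⋙ G ≅ 𝟭 𝒟₁) [F.Full] [F.Faithful]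
    [PreservesFiniteColimits F] [PreservesFiniteColimits G]
    (hP : ∀ P, Projective P → Projective (F.obj P))
    (𝒴 : Set ℬ) (good : IsGoodSubcat 𝒴) (hst : SupportTauTilting 𝒴)
    (hFG : ∀ Y ∈ 𝒴, F.obj (G.obj Y) ∈ 𝒴) : SupportTauTilting (imgCl G 𝒴) := by
  have : PreservesBinaryBiproducts F := preservesBinaryBiproducts_of_preservesBinaryCoproducts F
  have : F.Additive := Functor.additive_of_preservesBinaryBiproducts F
  have : PreservesBinaryBiproducts G := preservesBinaryBiproducts_of_preservesBinaryCoproducts G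
  have : G.Additive := Functor.additive_of_preservesBinaryBiproducts G
  have hF : ∀ X ∈ imgCl G 𝒴, F.obj X ∈ 𝒴 := by
    rintro X ⟨Y, hY, ⟨i⟩⟩
    exact good.1 (F.mapIso i) (hFG Y hY)
  have hG : ∀ Y ∈ 𝒴, G.obj Y ∈ imgCl G 𝒴 := fun Y hY => ⟨Y, hY, ⟨Iso.refl _⟩⟩
  have enat : ∀ {X Y : 𝒟₁} (g : X ⟶ Y), G.map (F.map g) ≫ e.hom.app Y = e.hom.app X ≫ g :=
    fun g => e.hom.naturality g
  have einv : ∀ X : 𝒟₁, e.inv.app X ≫ e.hom.app X = 𝟙 X := fun X => e.inv_hom_id_app X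
  obtain ⟨⟨hext, happ⟩, hcf⟩ := hst
  refine ⟨⟨?_, ?_⟩, ?_⟩
  · rintro M hM L ⟨N, hN, n, hn⟩
    refine subsingleton_ext_one_of_splits M L fun E a b w hS => ?_
    have : Epi b := hS.epi_g
    have hEx : ((ShortComplex.mk a b w).map F).Exact :=
      hS.exact.map_of_epi_of_preservesCokernel F hS.epi_g inferInstance
    have hwF : F.map a ≫ F.map b = 0 := by rw [← F.map_comp, w, F.map_zero]
    have hepi : Epi (kernel.lift (F.map b) (F.map a) hwF) :=
      hEx.epi_kernelLift
    obtain ⟨s, hs⟩ := exists_section_of_ext (F.map b)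
      (hext _ (hF M hM) _ ⟨F.obj N, hF N hN, F.map n ≫ kernel.lift (F.map b) (F.map a)
        hwF, epi_comp _ _⟩)
    refine ⟨F.preimage s, F.map_injective ?_⟩
    simp [hs]
  · intro P hPP
    obtain ⟨M₀, M₁, f, g, hM₀, hM₁, hg, ⟨w, hex⟩, -, hf⟩ := happ _ (hP P hPP)
    have w' : (e.inv.app P ≫ G.map f) ≫ G.map g = 0 := by
      rw [Category.assoc, ← G.map_comp, w, G.map_zero, comp_zero]
    refine ⟨G.obj M₀, G.obj M₁, e.inv.app P ≫ G.map f, G.map g, hG _ hM₀, hG _ hM₁,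
      inferInstance, ⟨w', ?_⟩, hG _ hM₀, ?_⟩
    · have hEx : ((ShortComplex.mk f g w).map G).Exact :=
        hex.map_of_epi_of_preservesCokernel G hg inferInstance
      refine (ShortComplex.exact_iff_of_iso (S₁ := (ShortComplex.mk f g w).map G)
        (S₂ := ShortComplex.mk _ _ w') (ShortComplex.isoMk (e.app P) (Iso.refl _)
        (Iso.refl _) ?_ ?_)).1 hEx
      · change e.hom.app P ≫ e.inv.app P ≫ G.map f = G.map f ≫ 𝟙 (G.obj M₀)
        rw [e.hom_inv_id_app_assoc]
        exact (Category.comp_id _).symm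
      · change 𝟙 (G.obj M₀) ≫ G.map g = G.map g ≫ 𝟙 (G.obj M₁)
        rw [Category.id_comp, Category.comp_id]
    · intro M' hM' g'
      obtain ⟨h, hh⟩ := hf _ (hF M' hM') (F.map g')
      refine ⟨G.map h ≫ e.hom.app M', ?_⟩
      rw [Category.assoc, ← G.map_comp_assoc, hh, enat, ← Category.assoc, einv, Category.id_comp]
  · intro A
    obtain ⟨Y, f, hY, hf⟩ := hcf (F.obj A)
    refine ⟨G.obj Y, G.map f ≫ e.hom.app A, hG _ hY, ?_⟩
    intro M' hM' g
    obtain ⟨h, hh⟩ := hf _ (hF M' hM') (F.map g)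
    refine ⟨e.inv.app M' ≫ G.map h, ?_⟩
    rw [Category.assoc, ← G.map_comp_assoc, hh, enat, ← Category.assoc, einv, Category.id_comp]

/-- If `𝒴` is a support τ-tilting subcategory of `ℬ`, `i^*` and `i^!` are exact,
`i_* i^!(𝒴) ⊆ 𝒴`, `i_* i^*(𝒴) ⊆ 𝒴`, `j_! j^*(𝒴) ⊆ 𝒴` and `j_* j^*(𝒴) ⊆ 𝒴`, then
`i^*(𝒴)` and `j^*(𝒴)` are support τ-tilting subcategories of `𝒜` and `𝒞` respectively. -/
theorem stmt_8
    {𝒜 : Type u₁} {ℬ : Type u₂} {𝒞 : Type u₃}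
    [Category.{v₁} 𝒜] [Category.{v₂} ℬ] [Category.{v₃} 𝒞]
    [Abelian 𝒜] [Abelian ℬ] [Abelian 𝒞]
    [EnoughProjectives 𝒜] [EnoughInjectives 𝒜]
    [EnoughProjectives ℬ] [EnoughInjectives ℬ]
    [EnoughProjectives 𝒞] [EnoughInjectives 𝒞]
    [HasExt.{w₁} 𝒜] [HasExt.{w₂} ℬ] [HasExt.{w₃} 𝒞]
    (R : Recollement 𝒜 ℬ 𝒞)
    (𝒴 : Set ℬ) (good : IsGoodSubcat 𝒴)
    (hst : SupportTauTilting 𝒴)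
    [PreservesFiniteLimits R.iUS] [PreservesFiniteColimits R.iUS]
    [PreservesFiniteLimits R.iUE] [PreservesFiniteColimits R.iUE]
    (h₁ : ∀ Y ∈ 𝒴, R.iStar.obj (R.iUE.obj Y) ∈ 𝒴)
    (h₂ : ∀ Y ∈ 𝒴, R.iStar.obj (R.iUS.obj Y) ∈ 𝒴)
    (h₃ : ∀ Y ∈ 𝒴, R.jLE.obj (R.jUS.obj Y) ∈ 𝒴)
    (h₄ : ∀ Y ∈ 𝒴, R.jLS.obj (R.jUS.obj Y) ∈ 𝒴) :
    SupportTauTilting (imgCl R.iUS 𝒴) ∧ SupportTauTilting (imgCl R.jUS 𝒴) := by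
  have := R.iStar_full
  have := R.iStar_faithful
  have := R.jLE_full
  have := R.jLE_faithful
  have : PreservesColimits R.iStar := R.adj₂.leftAdjoint_preservesColimits
  have : PreservesColimits R.jLE := R.adj₃.leftAdjoint_preservesColimits
  have : PreservesColimits R.jUS := R.adj₄.leftAdjoint_preservesColimits
  refine ⟨?_, ?_⟩
  · exact supportTauTilting_imgCl R.iStar R.iUS (asIso R.adj₁.counit)
      (fun P hP => R.adj₂.map_projective P hP) 𝒴 good hst h₂
  · exact supportTauTilting_imgCl R.jLE R.jUS (asIso R.adj₃.unit).symm
      (fun P hP => R.adj₃.map_projective P hP) 𝒴 good hst h₃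
end

section
/- Let (𝒜, ℬ, 𝒞) be a recollement of abelian categories, and let (ℰ, ℱ, 𝒢) and (ℰ', ℱ', 𝒢') be τ-cotorsion torsion triples of 𝒜 and 𝒞, respectively. Define 𝒵 = {Z ∈ ℬ | i^*(Z) ∈ ℰ ∩ ℱ, i^!(Z) ∈ ℰ ∩ ℱ, and j^*(Z) ∈ ℰ' ∩ ℱ'}. If i^* and i^! are exact, then (^{⊥1}(Fac(𝒵)), Fac(𝒵), 𝒵^{⊥0}) is a τ-cotorsion torsion triple of ℬ. -/
open CategoryTheory Limits Abelian

universe w₁ w₂ w₃ v₁ v₂ v₃ u₁ u₂ u₃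

variable {𝒟 : Type u₁} [Category.{v₁} 𝒟] [Abelian 𝒟]

section Helpers

open scoped ZeroObject
set_option linter.unusedSectionVars false

universe a₁ a₂ a₃ b₁ b₂ b₃ c₁ c₂ c₃

/-- Concrete form of the vanishing of `Ext¹(L, M)`. -/
def ExtVan {𝒳 : Type b₁} [Category.{a₁} 𝒳] [Abelian 𝒳] (L M : 𝒳) : Prop :=
  ∀ (S : ShortComplex 𝒳), S.ShortExact → (S.X₃ ≅ L) → ∀ u : S.X₁ ⟶ M, ∃ v : S.X₂ ⟶ M, S.f ≫ v = u

theorem ext_iff_extVan {𝒳 : Type b₁} [Category.{a₁} 𝒳] [Abelian 𝒳] [HasExt.{c₁} 𝒳]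
    [EnoughProjectives 𝒳] (L M : 𝒳) : Subsingleton (Ext L M 1) ↔ ExtVan L M := by
  constructor
  · intro hs S hS e u
    have hz : hS.extClass.comp (Ext.mk₀ u) (add_zero 1) = 0 := by
      have h1 : (Ext.mk₀ e.inv).comp (hS.extClass.comp (Ext.mk₀ u) (add_zero 1)) (zero_add 1) = 0 :=
        Subsingleton.elim _ _
      have h2 := congrArg (fun x => (Ext.mk₀ e.hom).comp x (zero_add 1)) h1
      simpa using h2
    obtain ⟨x, hx⟩ := Ext.contravariant_sequence_exact₁ hS M (Ext.mk₀ u) (add_zero 1) hz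
    obtain ⟨v, rfl⟩ := (Ext.mk₀_bijective _ _).2 x
    refine ⟨v, (Ext.mk₀_bijective _ _).1 ?_⟩
    simpa using hx
  · intro hv
    refine subsingleton_of_forall_eq 0 fun x => ?_
    let π := Projective.π L
    let S : ShortComplex 𝒳 := ShortComplex.mk (kernel.ι π) π (kernel.condition π)
    have hS : S.ShortExact := { exact := ShortComplex.exact_kernel π }
    obtain ⟨y, hy⟩ := Ext.contravariant_sequence_exact₃ hS M x
      (Ext.eq_zero_of_projective (P := Projective.over L) _) (add_zero 1)
    obtain ⟨u, rfl⟩ := (Ext.mk₀_bijective _ _).2 y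
    obtain ⟨v, rfl⟩ := hv S hS (Iso.refl _) u
    rw [← hy, ← Ext.mk₀_comp_mk₀, ShortComplex.ShortExact.extClass_comp_assoc]

/-- Two functors exhibiting a category as a product. -/
structure ProdData {𝒳 : Type b₁} {𝒴 : Type b₂} {𝒲 : Type b₃} [Category.{a₁} 𝒳] [Category.{a₂} 𝒴]
    [Category.{a₃} 𝒲] (F : 𝒴 ⥤ 𝒳) (G : 𝒴 ⥤ 𝒲) : Prop where
  full : ∀ {X Y : 𝒴} (a : F.obj X ⟶ F.obj Y) (b : G.obj X ⟶ G.obj Y),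
    ∃ v : X ⟶ Y, F.map v = a ∧ G.map v = b
  faith : ∀ {X Y : 𝒴} (u v : X ⟶ Y), F.map u = F.map v → G.map u = G.map v → u = v
  es : ∀ (A : 𝒳) (C : 𝒲), ∃ B : 𝒴, Nonempty (F.obj B ≅ A) ∧ Nonempty (G.obj B ≅ C)

namespace ProdData

section Basic

variable {𝒳 : Type b₁} {𝒴 : Type b₂} {𝒲 : Type b₃} [Category.{a₁} 𝒳] [Category.{a₂} 𝒴]
    [Category.{a₃} 𝒲] {F : 𝒴 ⥤ 𝒳} {G : 𝒴 ⥤ 𝒲}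

theorem symm (p : ProdData F G) : ProdData G F where
  full a b := by
    obtain ⟨v, h1, h2⟩ := p.full b a
    exact ⟨v, h2, h1⟩
  faith u v h1 h2 := p.faith u v h2 h1
  es A C := by
    obtain ⟨B, h1, h2⟩ := p.es C A
    exact ⟨B, h2, h1⟩

theorem epi (p : ProdData F G) {X Y : 𝒴} (f : X ⟶ Y) (h1 : Epi (F.map f)) (h2 : Epi (G.map f)) :
    Epi f where
  left_cancellation u v h := by
    apply p.faith
    · rw [← cancel_epi (F.map f), ← F.map_comp, h, F.map_comp]
    · rw [← cancel_epi (G.map f), ← G.map_comp, h, G.map_comp]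

theorem mono (p : ProdData F G) {X Y : 𝒴} (f : X ⟶ Y) (h1 : Mono (F.map f))
    (h2 : Mono (G.map f)) : Mono f where
  right_cancellation u v h := by
    apply p.faith
    · rw [← cancel_mono (F.map f), ← F.map_comp, h, F.map_comp]
    · rw [← cancel_mono (G.map f), ← G.map_comp, h, G.map_comp]

variable [Abelian 𝒳] [Abelian 𝒴] [Abelian 𝒲]

theorem projective (p : ProdData F G) (P : 𝒴) (hP : Projective P) : Projective (F.obj P) where
  factors {A₂ A₁} f e he := by
    obtain ⟨B₁, ⟨α₁⟩, ⟨β₁⟩⟩ := p.es A₁ (0 : 𝒲)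
    obtain ⟨B₂, ⟨α₂⟩, ⟨β₂⟩⟩ := p.es A₂ (0 : 𝒲)
    obtain ⟨e', he1, he2⟩ := p.full (α₂.hom ≫ e ≫ α₁.inv) (β₂.hom ≫ β₁.inv)
    obtain ⟨f', hf1, -⟩ := p.full (X := P) (f ≫ α₁.inv) (0 : G.obj P ⟶ G.obj B₁)
    have : Epi e' := p.epi e' (by rw [he1]; infer_instance) (by rw [he2]; infer_instance)
    obtain ⟨g, hg⟩ := Projective.factors f' e'
    refine ⟨F.map g ≫ α₂.hom, ?_⟩
    rw [← cancel_mono α₁.inv, ← hf1, ← hg, F.map_comp, he1]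
    simp
  
variable [PreservesFiniteLimits F] [PreservesFiniteColimits F]
  [PreservesFiniteLimits G] [PreservesFiniteColimits G]

theorem isZero (p : ProdData F G) (X : 𝒴) (h1 : IsZero (F.obj X)) (h2 : IsZero (G.obj X)) :
    IsZero X := by
  rw [IsZero.iff_id_eq_zero]
  exact p.faith _ _ (h1.eq_of_src _ _) (h2.eq_of_src _ _)

theorem exact (p : ProdData F G) (S : ShortComplex 𝒴) (h1 : (S.map F).Exact)
    (h2 : (S.map G).Exact) : S.Exact := by
  rw [ShortComplex.exact_iff_isZero_homology] at *
  exact p.isZero _ (h1.of_iso (S.mapHomologyIso F).symm) (h2.of_iso (S.mapHomologyIso G).symm)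

theorem shortExact (p : ProdData F G) (S : ShortComplex 𝒴) (h1 : (S.map F).ShortExact)
    (h2 : (S.map G).ShortExact) : S.ShortExact where
  exact := p.exact S h1.exact h2.exact
  mono_f := p.mono _ h1.mono_f h2.mono_f
  epi_g := p.epi _ h1.epi_g h2.epi_g

theorem extVan (p : ProdData F G) (L M : 𝒴) (h1 : ExtVan (F.obj L) (F.obj M))
    (h2 : ExtVan (G.obj L) (G.obj M)) : ExtVan L M := by
  intro S hS e u
  obtain ⟨v1, hv1⟩ := h1 (S.map F) (hS.map_of_exact F) (F.mapIso e) (F.map u)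
  obtain ⟨v2, hv2⟩ := h2 (S.map G) (hS.map_of_exact G) (G.mapIso e) (G.map u)
  obtain ⟨v, rfl, rfl⟩ := p.full v1 v2
  exact ⟨v, p.faith _ _ ((F.map_comp _ _).trans hv1) ((G.map_comp _ _).trans hv2)⟩

theorem extVan_left (p : ProdData F G) (L : 𝒴) (M : 𝒳)
    (hL : ∀ M' : 𝒴, (F.obj M' ≅ M) → IsZero (G.obj M') → ExtVan L M') :
    ExtVan (F.obj L) M := by
  intro S hS e u
  obtain ⟨K', ⟨k⟩, ⟨k2⟩⟩ := p.es S.X₁ (0 : 𝒲)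
  obtain ⟨E', ⟨E⟩, ⟨E2⟩⟩ := p.es S.X₂ (G.obj L)
  obtain ⟨M', ⟨m⟩, ⟨m2⟩⟩ := p.es M (0 : 𝒲)
  have hK : IsZero (G.obj K') := (isZero_zero _).of_iso k2
  obtain ⟨f', hf1, hf2⟩ := p.full (k.hom ≫ S.f ≫ E.inv) (0 : G.obj K' ⟶ G.obj E')
  obtain ⟨g', hg1, hg2⟩ := p.full (E.hom ≫ S.g ≫ e.hom) E2.hom
  obtain ⟨u', hu1, -⟩ := p.full (k.hom ≫ u ≫ m.inv) (0 : G.obj K' ⟶ G.obj M')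
  have w : f' ≫ g' = 0 := p.faith _ _ (by simp [hf1, hg1]) (by simp [hf2])
  have hS' : (ShortComplex.mk f' g' w).ShortExact := by
    apply p.shortExact
    · refine ShortComplex.shortExact_of_iso (ShortComplex.isoMk k.symm E.symm e ?_ ?_) hS
      · change k.inv ≫ F.map f' = S.f ≫ E.inv
        simp [hf1]
      · change E.inv ≫ F.map g' = S.g ≫ e.hom
        simp [hg1]
    · have : IsIso (G.map g') := by rw [hg2]; infer_instance
      refine { exact := ?_, mono_f := ?_, epi_g := ?_ }
      · rw [ShortComplex.exact_iff_mono _ (by exact hf2)]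
        exact (inferInstance : Mono (G.map g'))
      · exact ⟨fun _ _ _ => hK.eq_of_tgt _ _⟩
      · exact (inferInstance : Epi (G.map g'))
  obtain ⟨v', hv'⟩ := hL M' m ((isZero_zero _).of_iso m2) _ hS' (Iso.refl _) u'
  refine ⟨E.inv ≫ F.map v' ≫ m.hom, ?_⟩
  have h3 : F.map f' ≫ F.map v' = F.map u' := by rw [← F.map_comp]; exact congrArg _ hv'
  rw [hf1, hu1] at h3
  rw [← cancel_epi k.hom, ← cancel_mono m.inv]
  simpa using h3

end Basic

end ProdData

section Triple

variable {𝒳 : Type b₁} [Category.{a₁} 𝒳] [Abelian 𝒳] [HasExt.{c₁} 𝒳]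

theorem tors_zero {D T : Set 𝒳} (gD : IsGoodSubcat D) (h : TorsionPair D T) {X : 𝒳}
    (hX : IsZero X) : X ∈ D := by
  obtain ⟨A, B, f, g, hA, -, hf, -, -⟩ := h.2 X
  exact gD.1 ((IsZero.of_mono f hX).iso hX) hA

theorem tors_quot {D T : Set 𝒳} (gD : IsGoodSubcat D) (h : TorsionPair D T) {X Y : 𝒳}
    (f : X ⟶ Y) (hf : Epi f) (hX : X ∈ D) : Y ∈ D := by
  obtain ⟨A, B, a, b, hA, hB, ha, hb, w, hw⟩ := h.2 Y
  have h0 : f ≫ b = 0 := h.1 X hX B hB _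
  have hb0 : b = 0 := by rw [← cancel_epi f, h0, comp_zero]
  have : Epi a := (ShortComplex.exact_iff_epi _ hb0).1 hw
  have : IsIso a := isIso_of_mono_of_epi a
  exact gD.1 (asIso a) hA

theorem triple_fac [EnoughProjectives 𝒳] {L D T : Set 𝒳} (h : TauCotorsionTorsionTriple L D T)
    {X : 𝒳} (hX : X ∈ D) : ∃ Y ∈ L ∩ D, ∃ f : Y ⟶ X, Epi f := by
  obtain ⟨D₀, C₀, f, g, hD, -, -, -, hf⟩ := h.2.1 (Projective.over X) inferInstance
  obtain ⟨k, hk⟩ := hf.2 X hX (Projective.π X)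
  refine ⟨D₀, hD, k, ?_⟩
  have : Epi (f ≫ k) := by rw [hk]; infer_instance
  exact epi_of_epi f k

end Triple

namespace ProdData

variable {𝒳 : Type b₁} {𝒴 : Type b₂} {𝒲 : Type b₃} [Category.{a₁} 𝒳] [Category.{a₂} 𝒴]
    [Category.{a₃} 𝒲] {F : 𝒴 ⥤ 𝒳} {G : 𝒴 ⥤ 𝒲}
    [Abelian 𝒳] [Abelian 𝒴] [Abelian 𝒲]
    [PreservesFiniteLimits F] [PreservesFiniteColimits F]
    [PreservesFiniteLimits G] [PreservesFiniteColimits G]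

theorem exactLift (p : ProdData F G) {X Y Z : 𝒴} (f : X ⟶ Y) (g : Y ⟶ Z)
    {A₂ A₃ : 𝒳} {C₂ C₃ : 𝒲} (α₂ : F.obj Y ≅ A₂) (α₃ : F.obj Z ≅ A₃)
    (β₂ : G.obj Y ≅ C₂) (β₃ : G.obj Z ≅ C₃) {A₁ : 𝒳} {C₁ : 𝒲} (α₁ : F.obj X ≅ A₁)
    (β₁ : G.obj X ≅ C₁) (f₁ : A₁ ⟶ A₂) (g₁ : A₂ ⟶ A₃) (f₂ : C₁ ⟶ C₂) (g₂ : C₂ ⟶ C₃)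
    (hf1 : F.map f = α₁.hom ≫ f₁ ≫ α₂.inv) (hf2 : G.map f = β₁.hom ≫ f₂ ≫ β₂.inv)
    (hg1 : F.map g = α₂.hom ≫ g₁ ≫ α₃.inv) (hg2 : G.map g = β₂.hom ≫ g₂ ≫ β₃.inv)
    (h1 : ExactAt f₁ g₁) (h2 : ExactAt f₂ g₂) : ExactAt f g := by
  obtain ⟨w1, e1⟩ := h1
  obtain ⟨w2, e2⟩ := h2
  have w : f ≫ g = 0 := by
    apply p.faith
    · simp [hf1, hg1, reassoc_of% w1]
    · simp [hf2, hg2, reassoc_of% w2]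
  refine ⟨w, p.exact _ ?_ ?_⟩
  · refine ShortComplex.exact_of_iso (ShortComplex.isoMk α₁.symm α₂.symm α₃.symm ?_ ?_) e1
    · change α₁.inv ≫ F.map f = f₁ ≫ α₂.inv
      simp [hf1]
    · change α₂.inv ≫ F.map g = g₁ ≫ α₃.inv
      simp [hg1]
  · refine ShortComplex.exact_of_iso (ShortComplex.isoMk β₁.symm β₂.symm β₃.symm ?_ ?_) e2
    · change β₁.inv ≫ G.map f = f₂ ≫ β₂.inv
      simp [hf2]
    · change β₂.inv ≫ G.map g = g₂ ≫ β₃.inv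
      simp [hg2]

variable [EnoughProjectives 𝒳] [EnoughProjectives 𝒴] [EnoughProjectives 𝒲]
    [HasExt.{c₁} 𝒳] [HasExt.{c₂} 𝒴] [HasExt.{c₃} 𝒲]

theorem mem_fac_iff (p : ProdData F G) (L D T : Set 𝒳) (L' D' T' : Set 𝒲)
    (gL : IsGoodSubcat L) (gD : IsGoodSubcat D)
    (gL' : IsGoodSubcat L') (gD' : IsGoodSubcat D')
    (h : TauCotorsionTorsionTriple L D T) (h' : TauCotorsionTorsionTriple L' D' T') (B : 𝒴) :
    B ∈ Fac {Z : 𝒴 | F.obj Z ∈ L ∩ D ∧ G.obj Z ∈ L' ∩ D'} ↔ F.obj B ∈ D ∧ G.obj B ∈ D' := by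
  constructor
  · rintro ⟨Z, ⟨h1, h2⟩, f, hf⟩
    exact ⟨tors_quot gD h.2.2.2 (F.map f) inferInstance h1.2,
      tors_quot gD' h'.2.2.2 (G.map f) inferInstance h2.2⟩
  · rintro ⟨h1, h2⟩
    obtain ⟨Y, hY, f, hf⟩ := triple_fac h h1
    obtain ⟨Y', hY', f', hf'⟩ := triple_fac h' h2
    obtain ⟨Z, ⟨α⟩, ⟨β⟩⟩ := p.es Y Y'
    obtain ⟨v, hv1, hv2⟩ := p.full (α.hom ≫ f) (β.hom ≫ f')
    exact ⟨Z, ⟨⟨gL.1 α.symm hY.1, gD.1 α.symm hY.2⟩, ⟨gL'.1 β.symm hY'.1, gD'.1 β.symm hY'.2⟩⟩, v,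
      p.epi v (by rw [hv1]; infer_instance) (by rw [hv2]; infer_instance)⟩

theorem mem_perp_of (p : ProdData F G) (L D T : Set 𝒳) (L' D' T' : Set 𝒲)
    (gL : IsGoodSubcat L) (gD : IsGoodSubcat D)
    (gL' : IsGoodSubcat L') (gD' : IsGoodSubcat D')
    (h : TauCotorsionTorsionTriple L D T) (h' : TauCotorsionTorsionTriple L' D' T') (B : 𝒴)
    (h1 : F.obj B ∈ L) (h2 : G.obj B ∈ L') :
    B ∈ perpOneLeft (Fac {Z : 𝒴 | F.obj Z ∈ L ∩ D ∧ G.obj Z ∈ L' ∩ D'}) := by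
  intro M hM
  rw [p.mem_fac_iff L D T L' D' T' gL gD gL' gD' h h'] at hM
  rw [h.1] at h1
  rw [h'.1] at h2
  rw [ext_iff_extVan]
  exact p.extVan _ _ ((ext_iff_extVan _ _).1 (h1 _ hM.1)) ((ext_iff_extVan _ _).1 (h2 _ hM.2))

theorem of_mem_perp (p : ProdData F G) (L D T : Set 𝒳) (L' D' T' : Set 𝒲)
    (gL : IsGoodSubcat L) (gD : IsGoodSubcat D)
    (gL' : IsGoodSubcat L') (gD' : IsGoodSubcat D')
    (h : TauCotorsionTorsionTriple L D T) (h' : TauCotorsionTorsionTriple L' D' T') (B : 𝒴)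
    (hB : B ∈ perpOneLeft (Fac {Z : 𝒴 | F.obj Z ∈ L ∩ D ∧ G.obj Z ∈ L' ∩ D'})) :
    F.obj B ∈ L ∧ G.obj B ∈ L' := by
  constructor
  · rw [h.1]
    intro M hM
    rw [ext_iff_extVan]
    refine p.extVan_left B M fun M' e hz => (ext_iff_extVan _ _).1 (hB _ ?_)
    rw [p.mem_fac_iff L D T L' D' T' gL gD gL' gD' h h']
    exact ⟨gD.1 e.symm hM, tors_zero gD' h'.2.2.2 hz⟩
  · rw [h'.1]
    intro M hM
    rw [ext_iff_extVan]
    refine p.symm.extVan_left B M fun M' e hz => (ext_iff_extVan _ _).1 (hB _ ?_)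
    rw [p.mem_fac_iff L D T L' D' T' gL gD gL' gD' h h']
    exact ⟨tors_zero gD h.2.2.2 hz, gD'.1 e.symm hM⟩

theorem main (p : ProdData F G) (L D T : Set 𝒳) (L' D' T' : Set 𝒲)
    (gL : IsGoodSubcat L) (gD : IsGoodSubcat D)
    (gL' : IsGoodSubcat L') (gD' : IsGoodSubcat D')
    (h : TauCotorsionTorsionTriple L D T) (h' : TauCotorsionTorsionTriple L' D' T') :
    TauCotorsionTorsionTriple
      (perpOneLeft (Fac {Z : 𝒴 | F.obj Z ∈ L ∩ D ∧ G.obj Z ∈ L' ∩ D'}))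
      (Fac {Z : 𝒴 | F.obj Z ∈ L ∩ D ∧ G.obj Z ∈ L' ∩ D'})
      (perpZeroRight {Z : 𝒴 | F.obj Z ∈ L ∩ D ∧ G.obj Z ∈ L' ∩ D'}) := by
  have hfac := p.mem_fac_iff L D T L' D' T' gL gD gL' gD' h h'
  have hperp := p.mem_perp_of L D T L' D' T' gL gD gL' gD' h h'
  have hperp' := p.of_mem_perp L D T L' D' T' gL gD gL' gD' h h'
  refine ⟨rfl, ?_, ?_, ?_, ?_⟩
  · intro P hP
    obtain ⟨D₀, C₀, f₁, g₁, hD, hC, hg₁, he₁, hf₁⟩ := h.2.1 (F.obj P) (p.projective P hP)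
    obtain ⟨D₀', C₀', f₂, g₂, hD', hC', hg₂, he₂, hf₂⟩ :=
      h'.2.1 (G.obj P) (p.symm.projective P hP)
    obtain ⟨Y, ⟨α₂⟩, ⟨β₂⟩⟩ := p.es D₀ D₀'
    obtain ⟨Z, ⟨α₃⟩, ⟨β₃⟩⟩ := p.es C₀ C₀'
    obtain ⟨f, hf1, hf2⟩ := p.full (X := P) (f₁ ≫ α₂.inv) (f₂ ≫ β₂.inv)
    obtain ⟨g, hg1, hg2⟩ := p.full (α₂.hom ≫ g₁ ≫ α₃.inv) (β₂.hom ≫ g₂ ≫ β₃.inv)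
    have hY : Y ∈ Fac {Z : 𝒴 | F.obj Z ∈ L ∩ D ∧ G.obj Z ∈ L' ∩ D'} :=
      (hfac Y).2 ⟨gD.1 α₂.symm hD.2, gD'.1 β₂.symm hD'.2⟩
    refine ⟨Y, Z, f, g, ⟨hperp Y (gL.1 α₂.symm hD.1) (gL'.1 β₂.symm hD'.1), hY⟩,
      hperp Z (gL.1 α₃.symm hC) (gL'.1 β₃.symm hC'),
      p.epi g (by rw [hg1]; infer_instance) (by rw [hg2]; infer_instance),
      p.exactLift f g α₂ α₃ β₂ β₃ (Iso.refl _) (Iso.refl _) f₁ g₁ f₂ g₂ (by simpa using hf1)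
        (by simpa using hf2) hg1 hg2 he₁ he₂, hY, ?_⟩
    intro M' hM' u
    rw [hfac] at hM'
    obtain ⟨k₁, hk₁⟩ := hf₁.2 _ hM'.1 (F.map u)
    obtain ⟨k₂, hk₂⟩ := hf₂.2 _ hM'.2 (G.map u)
    obtain ⟨k, hk1, hk2⟩ := p.full (α₂.hom ≫ k₁) (β₂.hom ≫ k₂)
    exact ⟨k, p.faith _ _ (by simp [hf1, hk1, hk₁]) (by simp [hf2, hk2, hk₂])⟩
  · intro B
    obtain ⟨M₁, f₁, hM₁, hf₁⟩ := h.2.2.1 (F.obj B)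
    obtain ⟨M₂, f₂, hM₂, hf₂⟩ := h'.2.2.1 (G.obj B)
    obtain ⟨M, ⟨α⟩, ⟨β⟩⟩ := p.es M₁ M₂
    obtain ⟨f, hf1, hf2⟩ := p.full (X := M) (Y := B) (α.hom ≫ f₁) (β.hom ≫ f₂)
    refine ⟨M, f, ⟨hperp M (gL.1 α.symm hM₁.1) (gL'.1 β.symm hM₂.1),
      (hfac M).2 ⟨gD.1 α.symm hM₁.2, gD'.1 β.symm hM₂.2⟩⟩, ?_⟩
    rintro N ⟨hN, hN'⟩ u
    rw [hfac] at hN'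
    have hN := hperp' N hN
    obtain ⟨k₁, hk₁⟩ := hf₁ _ ⟨hN.1, hN'.1⟩ (F.map u)
    obtain ⟨k₂, hk₂⟩ := hf₂ _ ⟨hN.2, hN'.2⟩ (G.map u)
    obtain ⟨k, hk1, hk2⟩ := p.full (k₁ ≫ α.inv) (k₂ ≫ β.inv)
    exact ⟨k, p.faith _ _ (by simp [hf1, hk1, hk₁]) (by simp [hf2, hk2, hk₂])⟩
  · rintro X ⟨Z, hZ, e, he⟩ Y hY f
    rw [← cancel_epi e, hY Z hZ (e ≫ f), comp_zero]
  · intro B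
    obtain ⟨X₁, Y₁, f₁, g₁, hX₁, hY₁, hf₁, hg₁, he₁⟩ := h.2.2.2.2 (F.obj B)
    obtain ⟨X₂, Y₂, f₂, g₂, hX₂, hY₂, hf₂, hg₂, he₂⟩ := h'.2.2.2.2 (G.obj B)
    obtain ⟨X, ⟨α₁⟩, ⟨β₁⟩⟩ := p.es X₁ X₂
    obtain ⟨Y, ⟨α₃⟩, ⟨β₃⟩⟩ := p.es Y₁ Y₂
    obtain ⟨f, hf1, hf2⟩ := p.full (Y := B) (α₁.hom ≫ f₁) (β₁.hom ≫ f₂)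
    obtain ⟨g, hg1, hg2⟩ := p.full (X := B) (g₁ ≫ α₃.inv) (g₂ ≫ β₃.inv)
    refine ⟨X, Y, f, g, (hfac X).2 ⟨gD.1 α₁.symm hX₁, gD'.1 β₁.symm hX₂⟩, ?_,
      p.mono f (by rw [hf1]; infer_instance) (by rw [hf2]; infer_instance),
      p.epi g (by rw [hg1]; infer_instance) (by rw [hg2]; infer_instance),
      p.exactLift f g (Iso.refl _) α₃ (Iso.refl _) β₃ α₁ β₁ f₁ g₁ f₂ g₂ (by simpa using hf1)
        (by simpa using hf2) (by simpa using hg1) (by simpa using hg2) he₁ he₂⟩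
    rintro Z ⟨hZ, hZ'⟩ u
    apply p.faith
    · have := h.2.2.2.1 _ hZ.2 _ hY₁ (F.map u ≫ α₃.hom)
      rw [F.map_zero, ← cancel_mono α₃.hom, this, zero_comp]
    · have := h'.2.2.2.1 _ hZ'.2 _ hY₂ (G.map u ≫ β₃.hom)
      rw [G.map_zero, ← cancel_mono β₃.hom, this, zero_comp]

end ProdData

section Rec

variable {𝒳 : Type b₁} {𝒴 : Type b₂} {𝒲 : Type b₃} [Category.{a₁} 𝒳] [Category.{a₂} 𝒴]
    [Category.{a₃} 𝒲] [Abelian 𝒳] [Abelian 𝒴] [Abelian 𝒲] (R : Recollement 𝒳 𝒴 𝒲)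

theorem rec_ji (A : 𝒳) : IsZero (R.jUS.obj (R.iStar.obj A)) :=
  (R.essImage_iStar _).1 (R.iStar.obj_mem_essImage A)

theorem rec_i_jLE (C : 𝒲) : IsZero (R.iUS.obj (R.jLE.obj C)) := by
  rw [IsZero.iff_id_eq_zero]
  apply (R.adj₁.homEquiv _ _).injective
  apply (R.adj₃.homEquiv _ _).injective
  exact (rec_ji R _).eq_of_tgt _ _

theorem rec_iUE_jLS (C : 𝒲) : IsZero (R.iUE.obj (R.jLS.obj C)) := by
  rw [IsZero.iff_id_eq_zero]
  apply (R.adj₂.homEquiv _ _).symm.injective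
  apply (R.adj₄.homEquiv _ _).symm.injective
  exact (rec_ji R _).eq_of_src _ _

theorem rec_isZero_iUS (X : 𝒴) (h1 : IsZero (R.iUS.obj X)) (h2 : IsZero (R.jUS.obj X)) :
    IsZero X := by
  obtain ⟨A, ⟨e⟩⟩ := (R.essImage_iStar X).2 h2
  have := R.iStar_full
  have := R.iStar_faithful
  have hA : IsZero A := (h1.of_iso (R.iUS.mapIso e)).of_iso (asIso (R.adj₁.counit.app A)).symm
  have : R.iStar.IsRightAdjoint := ⟨_, ⟨R.adj₁⟩⟩
  exact (R.iStar.map_isZero hA).of_iso e.symm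

theorem rec_isZero_iUE (X : 𝒴) (h1 : IsZero (R.iUE.obj X)) (h2 : IsZero (R.jUS.obj X)) :
    IsZero X := by
  obtain ⟨A, ⟨e⟩⟩ := (R.essImage_iStar X).2 h2
  have := R.iStar_full
  have := R.iStar_faithful
  have hA : IsZero A := (h1.of_iso (R.iUE.mapIso e)).of_iso (asIso (R.adj₂.unit.app A))
  have : R.iStar.IsRightAdjoint := ⟨_, ⟨R.adj₁⟩⟩
  exact (R.iStar.map_isZero hA).of_iso e.symm

theorem rec_jLim : PreservesFiniteLimits R.jUS :=
  have := R.adj₃.rightAdjoint_preservesLimits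
  inferInstance

theorem rec_jColim : PreservesFiniteColimits R.jUS :=
  have := R.adj₄.leftAdjoint_preservesColimits
  inferInstance

theorem rec_i_jLS [PreservesFiniteLimits R.iUS] [PreservesFiniteColimits R.iUS]
    [PreservesFiniteColimits R.iUE] (C : 𝒲) : IsZero (R.iUS.obj (R.jLS.obj C)) := by
  have := rec_jLim R
  have := rec_jColim R
  have := R.jLE_full
  have := R.jLE_faithful
  let ε := R.adj₃.counit.app (R.jLS.obj C)
  have hj : IsIso (R.jUS.map ε) := by dsimp [ε]; infer_instance
  have hε : Epi ε := by
    apply Preadditive.epi_of_isZero_cokernel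
    apply rec_isZero_iUE R
    · exact IsZero.of_epi (R.iUE.map (cokernel.π ε)) (rec_iUE_jLS R C)
    · rw [IsZero.iff_id_eq_zero, ← cancel_epi (R.jUS.map (cokernel.π ε)),
        ← cancel_epi (R.jUS.map ε), ← R.jUS.map_comp_assoc, cokernel.condition]
      simp
  exact IsZero.of_epi (R.iUS.map ε) (rec_i_jLE R _)

/-- The canonical map to the product. -/
noncomputable def recPhi (X : 𝒴) :
    X ⟶ R.iStar.obj (R.iUS.obj X) ⊞ R.jLS.obj (R.jUS.obj X) :=
  biprod.lift (R.adj₁.unit.app X) (R.adj₄.unit.app X)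

theorem isIso_map_biprodLift {𝒰 : Type c₁} {𝒱 : Type c₂} [Category.{a₁} 𝒰] [Category.{a₂} 𝒱]
    [Abelian 𝒰] [Abelian 𝒱] (F : 𝒰 ⥤ 𝒱) [F.Additive] {X Y Z : 𝒰} (f : X ⟶ Y) (g : X ⟶ Z)
    (hf : IsIso (F.map f)) (hZ : IsZero (F.obj Z)) : IsIso (F.map (biprod.lift f g)) := by
  have h1 : IsIso (F.map (biprod.fst : Y ⊞ Z ⟶ Y)) := by
    refine ⟨F.map biprod.inl, ?_, ?_⟩
    · have h0 : F.map (biprod.snd : Y ⊞ Z ⟶ Z) = 0 := hZ.eq_of_tgt _ _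
      have := congrArg F.map (biprod.total (X := Y) (Y := Z))
      rw [F.map_add, F.map_comp, F.map_comp, h0, F.map_id] at this
      simpa using this
    · rw [← F.map_comp]; simp
  have h2 : IsIso (F.map (biprod.lift f g) ≫ F.map biprod.fst) := by
    rw [← F.map_comp]; simpa using hf
  exact IsIso.of_isIso_comp_right _ (F.map biprod.fst)

theorem isIso_map_biprodLift' {𝒰 : Type c₁} {𝒱 : Type c₂} [Category.{a₁} 𝒰] [Category.{a₂} 𝒱]
    [Abelian 𝒰] [Abelian 𝒱] (F : 𝒰 ⥤ 𝒱) [F.Additive] {X Y Z : 𝒰} (f : X ⟶ Y) (g : X ⟶ Z)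
    (hf : IsIso (F.map g)) (hZ : IsZero (F.obj Y)) : IsIso (F.map (biprod.lift f g)) := by
  have h1 : IsIso (F.map (biprod.snd : Y ⊞ Z ⟶ Z)) := by
    refine ⟨F.map biprod.inr, ?_, ?_⟩
    · have h0 : F.map (biprod.fst : Y ⊞ Z ⟶ Y) = 0 := hZ.eq_of_tgt _ _
      have := congrArg F.map (biprod.total (X := Y) (Y := Z))
      rw [F.map_add, F.map_comp, F.map_comp, h0, F.map_id] at this
      simpa using this
    · rw [← F.map_comp]; simp
  have h2 : IsIso (F.map (biprod.lift f g) ≫ F.map biprod.snd) := by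
    rw [← F.map_comp]; simpa using hf
  exact IsIso.of_isIso_comp_right _ (F.map biprod.snd)

theorem additive_of_exact {𝒰 : Type c₁} {𝒱 : Type c₂} [Category.{a₁} 𝒰] [Category.{a₂} 𝒱]
    [Abelian 𝒰] [Abelian 𝒱] (F : 𝒰 ⥤ 𝒱) [PreservesFiniteLimits F] : F.Additive :=
  F.additive_of_preserves_binary_products

theorem rec_isIso [PreservesFiniteLimits R.iUS] [PreservesFiniteColimits R.iUS]
    [PreservesFiniteColimits R.iUE] (X : 𝒴) : IsIso (recPhi R X) := by
  have := rec_jLim R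
  have := rec_jColim R
  have := additive_of_exact R.jUS
  have := additive_of_exact R.iUS
  have := R.iStar_full
  have := R.iStar_faithful
  have := R.jLS_full
  have := R.jLS_faithful
  have h1 : IsIso (R.iUS.map (recPhi R X)) :=
    isIso_map_biprodLift _ _ _ (by infer_instance) (rec_i_jLS R _)
  have h2 : IsIso (R.jUS.map (recPhi R X)) :=
    isIso_map_biprodLift' _ _ _ (by infer_instance) (rec_ji R _)
  have : Mono (recPhi R X) := by
    apply Preadditive.mono_of_isZero_kernel
    apply rec_isZero_iUS R
    · rw [IsZero.iff_id_eq_zero, ← cancel_mono (R.iUS.map (kernel.ι (recPhi R X))),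
        ← cancel_mono (R.iUS.map (recPhi R X)), Category.assoc, ← R.iUS.map_comp, kernel.condition]
      simp
    · rw [IsZero.iff_id_eq_zero, ← cancel_mono (R.jUS.map (kernel.ι (recPhi R X))),
        ← cancel_mono (R.jUS.map (recPhi R X)), Category.assoc, ← R.jUS.map_comp, kernel.condition]
      simp
  have : Epi (recPhi R X) := by
    apply Preadditive.epi_of_isZero_cokernel
    apply rec_isZero_iUS R
    · rw [IsZero.iff_id_eq_zero, ← cancel_epi (R.iUS.map (cokernel.π (recPhi R X))),
        ← cancel_epi (R.iUS.map (recPhi R X)), ← R.iUS.map_comp_assoc, cokernel.condition]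
      simp
    · rw [IsZero.iff_id_eq_zero, ← cancel_epi (R.jUS.map (cokernel.π (recPhi R X))),
        ← cancel_epi (R.jUS.map (recPhi R X)), ← R.jUS.map_comp_assoc, cokernel.condition]
      simp
  exact isIso_of_mono_of_epi _

theorem rec_prodData [PreservesFiniteLimits R.iUS] [PreservesFiniteColimits R.iUS]
    [PreservesFiniteColimits R.iUE] : ProdData R.iUS R.jUS := by
  have := rec_jLim R
  have := rec_jColim R
  have := additive_of_exact R.jUS
  have := additive_of_exact R.iUS
  have hiso := rec_isIso R
  have := R.iStar_full
  have := R.iStar_faithful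
  have := R.jLE_full
  have := R.jLE_faithful
  have := preservesBinaryBiproducts_of_preservesBinaryProducts R.iUS
  have := preservesBinaryBiproducts_of_preservesBinaryProducts R.jUS
  refine ⟨?_, ?_, ?_⟩
  · intro X Y a b
    let t : X ⟶ _ := biprod.lift (R.adj₁.homEquiv _ _ a) (R.adj₄.homEquiv _ _ b)
    have ht : (t ≫ inv (recPhi R Y)) ≫ recPhi R Y = t := by simp
    refine ⟨t ≫ inv (recPhi R Y), ?_, ?_⟩
    · apply (R.adj₁.homEquiv _ _).injective
      rw [Adjunction.homEquiv_unit, R.adj₁.unit_naturality]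
      have h1 : recPhi R Y ≫ biprod.fst = R.adj₁.unit.app Y := by simp [recPhi]
      rw [← h1, ← Category.assoc, ht]
      simp [t]
    · apply (R.adj₄.homEquiv _ _).injective
      rw [Adjunction.homEquiv_unit, R.adj₄.unit_naturality]
      have h1 : recPhi R Y ≫ biprod.snd = R.adj₄.unit.app Y := by simp [recPhi]
      rw [← h1, ← Category.assoc, ht]
      simp [t]
  · intro X Y u v h1 h2
    rw [← cancel_mono (recPhi R Y)]
    apply biprod.hom_ext
    · simp only [recPhi, Category.assoc, biprod.lift_fst]
      rw [← R.adj₁.unit_naturality, ← R.adj₁.unit_naturality, h1]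
    · simp only [recPhi, Category.assoc, biprod.lift_snd]
      rw [← R.adj₄.unit_naturality, ← R.adj₄.unit_naturality, h2]
  · intro A C
    refine ⟨R.iStar.obj A ⊞ R.jLE.obj C, ⟨?_⟩, ⟨?_⟩⟩
    · exact R.iUS.mapBiprod _ _ ≪≫ (isoBiprodZero (rec_i_jLE R C)).symm ≪≫
        asIso (R.adj₁.counit.app A)
    · exact R.jUS.mapBiprod _ _ ≪≫ (isoZeroBiprod (rec_ji R A)).symm ≪≫
        (asIso (R.adj₃.unit.app C)).symm

theorem rec_iUE_iso [PreservesFiniteLimits R.iUS] [PreservesFiniteColimits R.iUS]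
    [PreservesFiniteLimits R.iUE] [PreservesFiniteColimits R.iUE] (X : 𝒴) :
    Nonempty (R.iUS.obj X ≅ R.iUE.obj X) := by
  have := additive_of_exact R.iUE
  have hiso := rec_isIso R
  have := R.iStar_full
  have := R.iStar_faithful
  have := preservesBinaryBiproducts_of_preservesBinaryProducts R.iUE
  exact ⟨(R.iUE.mapIso (asIso (recPhi R X)) ≪≫ R.iUE.mapBiprod _ _ ≪≫
    (isoBiprodZero (rec_iUE_jLS R _)).symm ≪≫ (asIso (R.adj₂.unit.app _)).symm).symm⟩

end Rec

end Helpers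

/-- If `(ℰ, ℱ, 𝒢)` and `(ℰ', ℱ', 𝒢')` are τ-cotorsion torsion triples of `𝒜` and `𝒞`,
`𝒵 = {Z ∈ ℬ | i^*(Z) ∈ ℰ ∩ ℱ, i^!(Z) ∈ ℰ ∩ ℱ, j^*(Z) ∈ ℰ' ∩ ℱ'}`, and `i^*`, `i^!` are
exact, then `(^⊥₁(Fac 𝒵), Fac 𝒵, 𝒵^⊥₀)` is a τ-cotorsion torsion triple of `ℬ`. -/
theorem stmt_9
    {𝒜 : Type u₁} {ℬ : Type u₂} {𝒞 : Type u₃}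
    [Category.{v₁} 𝒜] [Category.{v₂} ℬ] [Category.{v₃} 𝒞]
    [Abelian 𝒜] [Abelian ℬ] [Abelian 𝒞]
    [EnoughProjectives 𝒜] [EnoughInjectives 𝒜]
    [EnoughProjectives ℬ] [EnoughInjectives ℬ]
    [EnoughProjectives 𝒞] [EnoughInjectives 𝒞]
    [HasExt.{w₁} 𝒜] [HasExt.{w₂} ℬ] [HasExt.{w₃} 𝒞]
    (R : Recollement 𝒜 ℬ 𝒞)
    (ℰ ℱ 𝒢 : Set 𝒜) (ℰ' ℱ' 𝒢' : Set 𝒞)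
    (goodE : IsGoodSubcat ℰ) (goodF : IsGoodSubcat ℱ) (goodG : IsGoodSubcat 𝒢)
    (goodE' : IsGoodSubcat ℰ') (goodF' : IsGoodSubcat ℱ') (goodG' : IsGoodSubcat 𝒢')
    (h : TauCotorsionTorsionTriple ℰ ℱ 𝒢) (h' : TauCotorsionTorsionTriple ℰ' ℱ' 𝒢')
    [PreservesFiniteLimits R.iUS] [PreservesFiniteColimits R.iUS]
    [PreservesFiniteLimits R.iUE] [PreservesFiniteColimits R.iUE] :
    TauCotorsionTorsionTriple
      (perpOneLeft (Fac {Z : ℬ | R.iUS.obj Z ∈ ℰ ∩ ℱ ∧ R.iUE.obj Z ∈ ℰ ∩ ℱ ∧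
        R.jUS.obj Z ∈ ℰ' ∩ ℱ'}))
      (Fac {Z : ℬ | R.iUS.obj Z ∈ ℰ ∩ ℱ ∧ R.iUE.obj Z ∈ ℰ ∩ ℱ ∧
        R.jUS.obj Z ∈ ℰ' ∩ ℱ'})
      (perpZeroRight {Z : ℬ | R.iUS.obj Z ∈ ℰ ∩ ℱ ∧ R.iUE.obj Z ∈ ℰ ∩ ℱ ∧
        R.jUS.obj Z ∈ ℰ' ∩ ℱ'}) := by
  have p := rec_prodData R
  have := rec_jLim R
  have := rec_jColim R
  have hZ : {Z : ℬ | R.iUS.obj Z ∈ ℰ ∩ ℱ ∧ R.iUE.obj Z ∈ ℰ ∩ ℱ ∧ R.jUS.obj Z ∈ ℰ' ∩ ℱ'} =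
      {Z : ℬ | R.iUS.obj Z ∈ ℰ ∩ ℱ ∧ R.jUS.obj Z ∈ ℰ' ∩ ℱ'} := by
    ext Z
    obtain ⟨e⟩ := rec_iUE_iso R Z
    exact ⟨fun hh => ⟨hh.1, hh.2.2⟩,
      fun hh => ⟨hh.1, ⟨goodE.1 e hh.1.1, goodF.1 e hh.1.2⟩, hh.2⟩⟩
  rw [hZ]
  exact p.main ℰ ℱ 𝒢 ℰ' ℱ' 𝒢' goodE goodF goodE' goodF' h h'
end
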